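/- arXiv:0803.2262 — 7 statements merged into one kernel-verified Lean document; each statement's English description precedes it below -/
import Mathlib

section
/- Let q be a prime power and let X, Y be arbitrary m×n matrices over GF(q). Then d_I(R(X),R(Y)) + d_I(C(X),C(Y)) − |rank(X) − rank(Y)| ≤ rank(X − Y) ≤ min{d_I(R(X),R(Y)), d_I(C(X),C(Y))} + min{rank(X), rank(Y)}. -/
open Module

noncomputable def injDist {F V : Type*} [Field F] [AddCommGroup V] [Module F V]
    (U W : Submodule F V) : ℕ :=
  finrank F ↥(U ⊔ W) - min (finrank F ↥U) (finrank F ↥W)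

def rowSpace {F : Type*} [CommRing F] {m n : ℕ} (X : Matrix (Fin m) (Fin n) F) :
    Submodule F (Fin n → F) :=
  LinearMap.range X.vecMulLinear

def colSpace {F : Type*} [CommRing F] {m n : ℕ} (X : Matrix (Fin m) (Fin n) F) :
    Submodule F (Fin m → F) :=
  LinearMap.range X.mulVecLin

noncomputable def minRankDist {F : Type*} [Field F] {m n : ℕ}
    (C : Set (Matrix (Fin m) (Fin n) F)) : ℕ :=
  sInf {e | ∃ X ∈ C, ∃ Y ∈ C, X ≠ Y ∧ (X - Y).rank = e}

noncomputable def minInjDist {F V : Type*} [Field F] [AddCommGroup V] [Module F V]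
    (S : Set (Submodule F V)) : ℕ :=
  sInf {e | ∃ U ∈ S, ∃ W ∈ S, U ≠ W ∧ injDist U W = e}

/-- Maximum cardinality of a nonempty code of `m × n` matrices whose ranks all lie in `I`
and in which any two distinct codewords are at rank distance at least `d`. -/
noncomputable def maxRankCode (F : Type*) [Field F] [Fintype F] (m n d : ℕ) (I : Set ℕ) : ℕ :=
  sSup {c : ℕ | ∃ C : Set (Matrix (Fin m) (Fin n) F), C.Nonempty ∧
    (∀ X ∈ C, X.rank ∈ I) ∧
    (∀ X ∈ C, ∀ Y ∈ C, X ≠ Y → d ≤ (X - Y).rank) ∧ C.ncard = c}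

/-- `A_R(q,m,n,d,r)` : maximum cardinality of a constant-rank code of constant rank `r`
and minimum rank distance at least `d` in `GF(q)^{m × n}`. -/
noncomputable def A_R (F : Type*) [Field F] [Fintype F] (m n d r : ℕ) : ℕ :=
  maxRankCode F m n d {r}

/-- `A_C(q,n,r,d)` : maximum cardinality of a constant-dimension code of dimension `r`
and minimum injection distance at least `d` in `GF(q)^n`. -/
noncomputable def A_C (F : Type*) [Field F] [Fintype F] (n r d : ℕ) : ℕ :=
  sSup {c : ℕ | ∃ S : Set (Submodule F (Fin n → F)), S.Nonempty ∧
    (∀ U ∈ S, finrank F ↥U = r) ∧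
    (∀ U ∈ S, ∀ V ∈ S, U ≠ V → d ≤ injDist U V) ∧ S.ncard = c}

/-- `N_R(q,m,n,r)` : number of `m × n` matrices over `GF(q)` of rank `r`. -/
noncomputable def N_R (F : Type*) [Field F] [Fintype F] (m n r : ℕ) : ℕ :=
  Nat.card {X : Matrix (Fin m) (Fin n) F // X.rank = r}

/-- `α(m,s) = ∏_{i=0}^{s-1} (q^m - q^i)`. -/
def alphaq (q m s : ℕ) : ℕ := ∏ i ∈ Finset.range s, (q ^ m - q ^ i)

/-- The Gaussian binomial `[n r]_q = α(n,r) / α(r,r)`. -/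
def gaussBinom (q n r : ℕ) : ℕ := alphaq q n r / alphaq q r r

/-- `K_q = ∏_{j=1}^∞ (1 - q^{-j})`. -/
noncomputable def Kq (q : ℕ) : ℝ := ∏' j : ℕ, (1 - ((q : ℝ))⁻¹ ^ (j + 1))

/-- `M(q,m,n,d,r)` : the number of codewords of rank `r` in an `(n, n-d+1, d)` linear MRD
code over `GF(q^m)`. -/
def Mcount (q m n d r : ℕ) : ℤ :=
  (gaussBinom q n r : ℤ) *
    ∑ j ∈ Finset.Icc d r, (-1 : ℤ) ^ (r - j) * (gaussBinom q r j : ℤ) *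
      (q : ℤ) ^ ((r - j) * (r - j - 1) / 2) * ((q : ℤ) ^ (m * (j - d + 1)) - 1)

lemma finrank_colSpace' {F : Type*} [Field F] {m n : ℕ} (X : Matrix (Fin m) (Fin n) F) :
    finrank F (colSpace X) = X.rank := rfl

lemma finrank_vecMul_range {F ι κ : Type*} [Field F] [Fintype ι] [Fintype κ] (X : Matrix ι κ F) :
    finrank F (LinearMap.range X.vecMulLinear) = X.rank := by
  rw [← Matrix.rank_transpose, Matrix.rank, Matrix.mulVecLin_transpose]

lemma finrank_rowSpace' {F : Type*} [Field F] {m n : ℕ} (X : Matrix (Fin m) (Fin n) F) :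
    finrank F (rowSpace X) = X.rank := finrank_vecMul_range X

lemma rank_sub_le_col {F : Type*} [Field F] {m n : ℕ} (X Y : Matrix (Fin m) (Fin n) F) :
    (X - Y).rank ≤ finrank F ↥(colSpace X ⊔ colSpace Y) := by
  rw [← finrank_colSpace']
  apply Submodule.finrank_mono
  rintro _ ⟨v, rfl⟩
  rw [Matrix.mulVecLin_apply, Matrix.sub_mulVec]
  exact Submodule.sub_mem _ (Submodule.mem_sup_left ⟨v, rfl⟩) (Submodule.mem_sup_right ⟨v, rfl⟩)

lemma rank_sub_le_row {F : Type*} [Field F] {m n : ℕ} (X Y : Matrix (Fin m) (Fin n) F) :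
    (X - Y).rank ≤ finrank F ↥(rowSpace X ⊔ rowSpace Y) := by
  rw [← finrank_rowSpace']
  apply Submodule.finrank_mono
  rintro _ ⟨v, rfl⟩
  rw [Matrix.vecMulLinear_apply, Matrix.vecMul_sub]
  exact Submodule.sub_mem _ (Submodule.mem_sup_left ⟨v, rfl⟩) (Submodule.mem_sup_right ⟨v, rfl⟩)

lemma row_sup_le {F : Type*} [Field F] {m n : ℕ} (X Y : Matrix (Fin m) (Fin n) F) :
    finrank F ↥(rowSpace X ⊔ rowSpace Y) +
      finrank F ↥(LinearMap.ker X.mulVecLin ⊓ LinearMap.ker Y.mulVecLin) ≤ n := by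
  have h1 : finrank F ↥(rowSpace X ⊔ rowSpace Y) ≤ (Matrix.fromRows X Y).rank := by
    rw [← finrank_vecMul_range]
    apply Submodule.finrank_mono
    apply sup_le
    · rintro _ ⟨v, rfl⟩
      exact ⟨Sum.elim v 0, by simp [Matrix.vecMul_fromRows]⟩
    · rintro _ ⟨v, rfl⟩
      exact ⟨Sum.elim 0 v, by simp [Matrix.vecMul_fromRows]⟩
  have h2 : LinearMap.ker X.mulVecLin ⊓ LinearMap.ker Y.mulVecLin ≤
      LinearMap.ker (Matrix.fromRows X Y).mulVecLin := by
    rintro v ⟨hx, hy⟩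
    simp only [SetLike.mem_coe, LinearMap.mem_ker, Matrix.mulVecLin_apply] at hx hy ⊢
    rw [Matrix.fromRows_mulVec, hx, hy]
    ext i; cases i <;> rfl
  have h3 := LinearMap.finrank_range_add_finrank_ker (Matrix.fromRows X Y).mulVecLin
  have h4 := Submodule.finrank_mono h2
  rw [Module.finrank_fin_fun] at h3
  unfold Matrix.rank at h1
  omega

lemma key_le {F : Type*} [Field F] {m n : ℕ} (X Y : Matrix (Fin m) (Fin n) F) :
    finrank F ↥(rowSpace X ⊔ rowSpace Y) + finrank F ↥(colSpace X ⊔ colSpace Y) ≤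
      (X - Y).rank + X.rank + Y.rank := by
  have h1 := row_sup_le X Y
  have h2 := Submodule.finrank_sup_add_finrank_inf_eq (colSpace X) (colSpace Y)
  rw [finrank_colSpace', finrank_colSpace'] at h2
  have h3 := LinearMap.finrank_range_add_finrank_ker (X - Y).mulVecLin
  rw [Module.finrank_fin_fun] at h3
  change (X - Y).rank + _ = n at h3
  set K := LinearMap.ker (X - Y).mulVecLin with hK
  have hmem : ∀ v ∈ K, X.mulVecLin v = Y.mulVecLin v := by
    intro v hv
    rw [hK, LinearMap.mem_ker, Matrix.mulVecLin_apply, Matrix.sub_mulVec, sub_eq_zero] at hv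
    exact hv
  have h4 := LinearMap.finrank_range_add_finrank_ker (X.mulVecLin.domRestrict K)
  have h5 : finrank F (LinearMap.range (X.mulVecLin.domRestrict K)) ≤
      finrank F ↥(colSpace X ⊓ colSpace Y) := by
    apply Submodule.finrank_mono
    rintro _ ⟨⟨v, hv⟩, rfl⟩
    exact ⟨⟨v, rfl⟩, ⟨v, (hmem v hv).symm⟩⟩
  have h6 : finrank F (LinearMap.ker (X.mulVecLin.domRestrict K)) ≤
      finrank F ↥(LinearMap.ker X.mulVecLin ⊓ LinearMap.ker Y.mulVecLin) := by
    rw [(Submodule.equivMapOfInjective K.subtype K.injective_subtype _).finrank_eq]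
    apply Submodule.finrank_mono
    rintro _ ⟨⟨v, hv⟩, hv2, rfl⟩
    have hx : X.mulVecLin v = 0 := hv2
    exact ⟨hx, (hmem v hv).symm.trans hx⟩
  omega

theorem stmt0 {q m n : ℕ} (F : Type*) [Field F] [Fintype F] (hF : Fintype.card F = q)
    (X Y : Matrix (Fin m) (Fin n) F) :
    injDist (rowSpace X) (rowSpace Y) + injDist (colSpace X) (colSpace Y)
        - Nat.dist X.rank Y.rank ≤ (X - Y).rank ∧
      (X - Y).rank ≤
        min (injDist (rowSpace X) (rowSpace Y)) (injDist (colSpace X) (colSpace Y))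
          + min X.rank Y.rank := by
  have hk := key_le X Y
  have hr := rank_sub_le_row X Y
  have hc := rank_sub_le_col X Y
  have a1 := Submodule.finrank_mono (le_sup_left : rowSpace X ≤ rowSpace X ⊔ rowSpace Y)
  have a2 := Submodule.finrank_mono (le_sup_left : colSpace X ≤ colSpace X ⊔ colSpace Y)
  have a3 := Submodule.finrank_mono (le_sup_right : rowSpace Y ≤ rowSpace X ⊔ rowSpace Y)
  have a4 := Submodule.finrank_mono (le_sup_right : colSpace Y ≤ colSpace X ⊔ colSpace Y)
  rw [finrank_rowSpace'] at a1 a3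
  rw [finrank_colSpace'] at a2 a4
  unfold injDist Nat.dist
  rw [finrank_rowSpace', finrank_rowSpace', finrank_colSpace', finrank_colSpace']
  omega
end

section
/- Let q be a prime power and 1 ≤ d ≤ r ≤ n ≤ m. Then for every integer p with 0 ≤ p ≤ r: min{A_C(q,n,r,d+p), A_C(q,m,r,r−p)} ≤ A_R(q,m,n,d+r,r) ≤ A_C(q,n,r,d). -/
open Module

theorem sylv {F : Type*} [Field F] {m n : ℕ} {k : Type*} [Fintype k] [DecidableEq k]
    (P : Matrix (Fin m) k F) (Q : Matrix k (Fin n) F) :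
    P.rank + Q.rank ≤ (P * Q).rank + Fintype.card k := by
  have h1 := LinearMap.finrank_range_add_finrank_ker P.mulVecLin
  have h2 := LinearMap.finrank_range_add_finrank_ker
    (P.mulVecLin.domRestrict (LinearMap.range Q.mulVecLin))
  have h3 : LinearMap.range (P.mulVecLin.domRestrict (LinearMap.range Q.mulVecLin))
      = LinearMap.range (P * Q).mulVecLin := by
    rw [LinearMap.range_domRestrict, Matrix.mulVecLin_mul, LinearMap.range_comp]
  have h4 : finrank F (LinearMap.ker (P.mulVecLin.domRestrict (LinearMap.range Q.mulVecLin)))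
      ≤ finrank F (LinearMap.ker P.mulVecLin) := by
    rw [LinearMap.ker_domRestrict]
    rw [(Submodule.equivMapOfInjective (LinearMap.range Q.mulVecLin).subtype
      Subtype.val_injective _).finrank_eq]
    apply Submodule.finrank_mono
    rintro _ ⟨x, hx, rfl⟩
    exact hx
  rw [h3] at h2
  rw [Module.finrank_fintype_fun_eq_card] at h1
  simp only [Matrix.rank]
  omega

/-- A subspace of dimension `r` is spanned by `r` vectors. -/
theorem exists_basis_fun {F : Type*} [Field F] {n r : ℕ} (U : Submodule F (Fin n → F))
    (h : finrank F U = r) : ∃ B : Fin r → Fin n → F, Submodule.span F (Set.range B) = U := by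
  refine ⟨fun i => ((finBasisOfFinrankEq F U h) i : Fin n → F), ?_⟩
  have := (finBasisOfFinrankEq F U h).span_eq
  have h2 := congrArg (Submodule.map U.subtype) this
  rw [Submodule.map_span, Submodule.map_top, Submodule.range_subtype, ← Set.range_comp] at h2
  exact h2

theorem ncard_bdd {α : Type*} [Finite α] (p : Set α → Prop) :
    BddAbove {c : ℕ | ∃ C : Set α, p C ∧ C.ncard = c} := by
  refine ⟨Nat.card α, ?_⟩
  rintro c ⟨C, -, rfl⟩
  exact Set.ncard_le_card C

theorem A_C_spec (F : Type*) [Field F] [Fintype F] (n r d : ℕ) (h : r ≤ n) :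
    ∃ S : Set (Submodule F (Fin n → F)), S.Nonempty ∧
    (∀ U ∈ S, finrank F ↥U = r) ∧
    (∀ U ∈ S, ∀ V ∈ S, U ≠ V → d ≤ injDist U V) ∧ S.ncard = A_C F n r d := by
  have hb := ncard_bdd (α := Submodule F (Fin n → F)) (fun S => S.Nonempty ∧
    (∀ U ∈ S, finrank F ↥U = r) ∧
    (∀ U ∈ S, ∀ V ∈ S, U ≠ V → d ≤ injDist U V))
  simp only [and_assoc] at hb
  refine Nat.sSup_mem ?_ hb
  obtain ⟨U, hU⟩ : ∃ U : Submodule F (Fin n → F), finrank F U = r := by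
    obtain ⟨f, hf⟩ := exists_linearIndependent_of_le_finrank (R := F) (M := Fin n → F) (n := r)
      (by simpa using h)
    exact ⟨_, (finrank_span_eq_card hf).trans (Fintype.card_fin r)⟩
  refine ⟨1, {U}, ⟨U, rfl⟩, ?_, ?_, Set.ncard_singleton U⟩
  · rintro _ rfl; exact hU
  · rintro _ rfl _ rfl h; exact absurd rfl h

theorem le_A_C {F : Type*} [Field F] [Fintype F] {n r d : ℕ}
    (S : Set (Submodule F (Fin n → F))) (h1 : S.Nonempty)
    (h2 : ∀ U ∈ S, finrank F ↥U = r)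
    (h3 : ∀ U ∈ S, ∀ V ∈ S, U ≠ V → d ≤ injDist U V) : S.ncard ≤ A_C F n r d := by
  have hb := ncard_bdd (α := Submodule F (Fin n → F)) (fun S => S.Nonempty ∧
    (∀ U ∈ S, finrank F ↥U = r) ∧
    (∀ U ∈ S, ∀ V ∈ S, U ≠ V → d ≤ injDist U V))
  simp only [and_assoc] at hb
  exact le_csSup hb ⟨S, h1, h2, h3, rfl⟩

theorem le_A_R {F : Type*} [Field F] [Fintype F] {m n r d : ℕ}
    (C : Set (Matrix (Fin m) (Fin n) F)) (h1 : C.Nonempty)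
    (h2 : ∀ X ∈ C, X.rank = r)
    (h3 : ∀ X ∈ C, ∀ Y ∈ C, X ≠ Y → d ≤ (X - Y).rank) : C.ncard ≤ A_R F m n d r := by
  have hb := ncard_bdd (α := Matrix (Fin m) (Fin n) F) (fun C => C.Nonempty ∧
    (∀ X ∈ C, X.rank ∈ ({r} : Set ℕ)) ∧
    (∀ X ∈ C, ∀ Y ∈ C, X ≠ Y → d ≤ (X - Y).rank))
  simp only [and_assoc] at hb
  exact le_csSup hb ⟨C, h1, h2, h3, rfl⟩

theorem lower_rank {F : Type*} [Field F] {m n r : ℕ} (A A' : Fin r → Fin m → F)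
    (B B' : Fin r → Fin n → F) :
    finrank F ↥(Submodule.span F (Set.range A) ⊔ Submodule.span F (Set.range A')) +
    finrank F ↥(Submodule.span F (Set.range B) ⊔ Submodule.span F (Set.range B')) ≤
    ((Matrix.of A).transpose * Matrix.of B - (Matrix.of A').transpose * Matrix.of B').rank
      + 2 * r := by
  have h := sylv (Matrix.fromRows (Matrix.of A) (Matrix.of A')).transpose
    (Matrix.fromRows (Matrix.of B) (-Matrix.of B'))
  rw [Matrix.rank_transpose, Matrix.rank_eq_finrank_span_row, Matrix.rank_eq_finrank_span_row,
    Matrix.transpose_fromRows, Matrix.fromCols_mul_fromRows] at h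
  have e1 : Set.range (Matrix.fromRows (Matrix.of A) (Matrix.of A')).row
      = Set.range A ∪ Set.range A' := by
    exact Set.Sum.elim_range A A'
  have e2 : Set.range (Matrix.fromRows (Matrix.of B) (-Matrix.of B')).row
      = Set.range B ∪ Set.range (-B') := by
    exact Set.Sum.elim_range B (-B')
  have e3 : Submodule.span F (Set.range (-B')) = Submodule.span F (Set.range B') := by
    have : Set.range (-B') = -Set.range B' := by
      ext x
      simp [neg_eq_iff_eq_neg]
    rw [this, Submodule.span_neg]
  rw [e1, e2, Submodule.span_union, Submodule.span_union, e3, Matrix.mul_neg,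
    ← sub_eq_add_neg] at h
  simp only [Fintype.card_sum, Fintype.card_fin] at h
  omega

theorem rank_mul_bases {F : Type*} [Field F] {m n r : ℕ} (A : Fin r → Fin m → F)
    (B : Fin r → Fin n → F) (hA : finrank F (Submodule.span F (Set.range A)) = r)
    (hB : finrank F (Submodule.span F (Set.range B)) = r) :
    ((Matrix.of A).transpose * Matrix.of B).rank = r := by
  have h := sylv (Matrix.of A).transpose (Matrix.of B)
  have h2 : ((Matrix.of A).transpose * Matrix.of B).rank ≤ (Matrix.of B).rank :=
    Matrix.rank_mul_le_right _ _
  have h3 : (Matrix.of A).transpose.rank = r := by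
    rw [Matrix.rank_transpose, Matrix.rank_eq_finrank_span_row]; exact hA
  have h4 : (Matrix.of B).rank = r := by
    rw [Matrix.rank_eq_finrank_span_row]; exact hB
  rw [h3, h4, Fintype.card_fin] at h
  omega

theorem upper_part {m n d r : ℕ} (F : Type*) [Field F] [Fintype F] (hd1 : 1 ≤ d) (hrn : r ≤ n) :
    A_R F m n (d + r) r ≤ A_C F n r d := by
  refine csSup_le' ?_
  rintro c ⟨C, hne, hr, hd, rfl⟩
  let f : Matrix (Fin m) (Fin n) F → Submodule F (Fin n → F) :=
    fun X => Submodule.span F (Set.range X.row)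
  have hf : ∀ X ∈ C, finrank F (f X) = r := fun X hX => by
    rw [← Matrix.rank_eq_finrank_span_row]; exact hr X hX
  have key : ∀ X ∈ C, ∀ Y ∈ C, X ≠ Y → d ≤ injDist (f X) (f Y) := by
    intro X hX Y hY hne
    have h1 := hd X hX Y hY hne
    have h2 : (X - Y).rank ≤ finrank F ↥(f X ⊔ f Y) := by
      rw [Matrix.rank_eq_finrank_span_row]
      apply Submodule.finrank_mono
      rw [Submodule.span_le]
      rintro _ ⟨i, rfl⟩
      exact Submodule.sub_mem _
        (Submodule.mem_sup_left (Submodule.subset_span ⟨i, rfl⟩))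
        (Submodule.mem_sup_right (Submodule.subset_span ⟨i, rfl⟩))
    rw [injDist, hf X hX, hf Y hY, min_self]
    omega
  have hinj : Set.InjOn f C := by
    intro X hX Y hY h
    by_contra hne
    have := key X hX Y hY hne
    rw [h, injDist, sup_idem, min_self] at this
    omega
  rw [← hinj.ncard_image]
  apply le_A_C _ (hne.image f)
  · rintro _ ⟨X, hX, rfl⟩; exact hf X hX
  · rintro _ ⟨X, hX, rfl⟩ _ ⟨Y, hY, rfl⟩ h
    exact key X hX Y hY (fun e => h (e ▸ rfl))

theorem lower_part {m n d r p : ℕ} (F : Type*) [Field F] [Fintype F]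
    (hd1 : 1 ≤ d) (hrn : r ≤ n) (hnm : n ≤ m) (hp : p ≤ r) :
    min (A_C F n r (d + p)) (A_C F m r (r - p)) ≤ A_R F m n (d + r) r := by
  obtain ⟨S, hS, hSr, hSd, hSc⟩ := A_C_spec F n r (d + p) hrn
  obtain ⟨T, hT, hTr, hTd, hTc⟩ := A_C_spec F m r (r - p) (hrn.trans hnm)
  rw [← hSc, ← hTc]
  obtain ⟨S', hS', hS'c⟩ := Set.exists_subset_card_eq (min_le_left S.ncard T.ncard)
  obtain ⟨T', hT', hT'c⟩ := Set.exists_subset_card_eq (min_le_right S.ncard T.ncard)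
  have hpos : 0 < min S.ncard T.ncard :=
    lt_min ((Set.ncard_pos S.toFinite).2 hS) ((Set.ncard_pos T.toFinite).2 hT)
  have hcard : Nat.card S' = Nat.card T' := by
    rw [Nat.card_coe_set_eq, Nat.card_coe_set_eq, hS'c, hT'c]
  obtain ⟨e⟩ : Nonempty (S' ≃ T') := Finite.card_eq.1 hcard
  choose B hB using fun U : S' => exists_basis_fun U.1 (hSr U.1 (hS' U.2))
  choose A hA using fun U : S' => exists_basis_fun (e U).1 (hTr (e U).1 (hT' (e U).2))
  let g : S' → Matrix (Fin m) (Fin n) F :=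
    fun U => (Matrix.of (A U)).transpose * Matrix.of (B U)
  have key : ∀ U V : S', U ≠ V → d + r ≤ (g U - g V).rank := by
    intro U V hne
    have h := lower_rank (A U) (A V) (B U) (B V)
    rw [hA, hA, hB, hB] at h
    have h1 := hSd U.1 (hS' U.2) V.1 (hS' V.2) (fun h => hne (Subtype.ext h))
    have h2 := hTd (e U).1 (hT' (e U).2) (e V).1 (hT' (e V).2)
      (fun h => hne (e.injective (Subtype.ext h)))
    rw [injDist, hSr _ (hS' U.2), hSr _ (hS' V.2), min_self] at h1
    rw [injDist, hTr _ (hT' (e U).2), hTr _ (hT' (e V).2), min_self] at h2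
    have h3 : r ≤ finrank F ↥((e U).1 ⊔ (e V).1) := by
      rw [← hTr _ (hT' (e U).2)]
      exact Submodule.finrank_mono le_sup_left
    change _ ≤ (g U - g V).rank + _ at h
    omega
  have hinj : Function.Injective g := by
    intro U V h
    by_contra hne
    have := key U V hne
    rw [h, sub_self, Matrix.rank_zero] at this
    omega
  have hc : (Set.range g).ncard = min S.ncard T.ncard := by
    rw [← Set.image_univ, Set.ncard_image_of_injective _ hinj, Set.ncard_univ,
      Nat.card_coe_set_eq, hS'c]
  rw [← hc]
  apply le_A_R
  · apply Set.nonempty_of_ncard_ne_zero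
    omega
  · rintro _ ⟨U, rfl⟩
    apply rank_mul_bases
    · rw [hA]; exact hTr _ (hT' (e U).2)
    · rw [hB]; exact hSr _ (hS' U.2)
  · rintro _ ⟨U, rfl⟩ _ ⟨V, rfl⟩ h
    exact key U V (fun e => h (e ▸ rfl))

theorem stmt4 {q m n d r p : ℕ} (F : Type*) [Field F] [Fintype F] (hF : Fintype.card F = q)
    (hd1 : 1 ≤ d) (hdr : d ≤ r) (hrn : r ≤ n) (hnm : n ≤ m) (hp : p ≤ r) :
    min (A_C F n r (d + p)) (A_C F m r (r - p)) ≤ A_R F m n (d + r) r ∧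
      A_R F m n (d + r) r ≤ A_C F n r d := by
  exact ⟨lower_part F hd1 hrn hnm hp, upper_part F hd1 hrn⟩
end

section
/- Let q be a prime power, 2r ≤ n ≤ m, and 1 ≤ d ≤ r. If either d = r or m ≥ m₀ where m₀ = (n−r)(r−d+1) + r + 1, then A_R(q,m,n,d+r,r) = A_C(q,n,r,d). -/
open Module

namespace Stmt5Aux

lemma exists_field (F : Type*) [Field F] [Fintype F] (N : ℕ) (hN : 0 < N) :
    ∃ (L : Type) (_ : Field L) (_ : Fintype L) (_ : Algebra F L), finrank F L = N := by
  obtain ⟨p, hp⟩ := CharP.exists F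
  have : Fact (Nat.Prime p) := ⟨CharP.char_is_prime F p⟩
  have : NeZero N := ⟨hN.ne'⟩
  exact ⟨FiniteField.Extension F p N, inferInstance, Fintype.ofFinite _, inferInstance,
    FiniteField.finrank_extension F p N⟩

lemma exists_basis_matrix {F : Type*} [Field F] {n r : ℕ} (U : Submodule F (Fin n → F))
    (hU : finrank F U = r) : ∃ B : Matrix (Fin r) (Fin n) F,
      LinearIndependent F B.row ∧ Submodule.span F (Set.range B.row) = U := by
  let b := finBasisOfFinrankEq F U hU
  refine ⟨Matrix.of fun i => (b i : Fin n → F), ?_, ?_⟩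
  · exact b.linearIndependent.map' U.subtype (Submodule.ker_subtype U)
  · have := congrArg (Submodule.map U.subtype) b.span_eq
    rw [Submodule.map_span, Submodule.map_subtype_top, ← Set.range_comp] at this
    exact this

lemma rowSpace_eq {F : Type*} [Field F] {m n : ℕ} (X : Matrix (Fin m) (Fin n) F) :
    rowSpace X = Submodule.span F (Set.range X.row) := by
  rw [rowSpace, range_vecMulLinear]

lemma rank_eq_rowSpace {F : Type*} [Field F] {m n : ℕ} (X : Matrix (Fin m) (Fin n) F) :
    X.rank = finrank F (rowSpace X) := by
  rw [rowSpace_eq, Matrix.rank_eq_finrank_span_row]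

lemma rank_mul_inj {F : Type*} [Field F] {m n : ℕ} {ι : Type*} [Fintype ι]
    (A : Matrix (Fin m) ι F)
    (B : Matrix ι (Fin n) F) (hA : ∀ x, A.mulVec x = 0 → x = 0) : (A * B).rank = B.rank := by
  have hi : Function.Injective A.mulVecLin := by
    rw [← LinearMap.ker_eq_bot, LinearMap.ker_eq_bot']
    intro x hx; exact hA x hx
  unfold Matrix.rank
  rw [Matrix.mulVecLin_mul, LinearMap.range_comp]
  exact (Submodule.equivMapOfInjective _ hi _).finrank_eq.symm

lemma rank_sub_eq {F : Type*} [Field F] {m n r : ℕ}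
    (A A' : Matrix (Fin m) (Fin r) F) (B B' : Matrix (Fin r) (Fin n) F)
    (hA : ∀ x y, A.mulVec x = A'.mulVec y → x = 0 ∧ y = 0) :
    (A * B - A' * B').rank = finrank F
      ↥(Submodule.span F (Set.range B.row) ⊔ Submodule.span F (Set.range B'.row)) := by
  have h1 : A * B - A' * B' = Matrix.fromCols A (-A') * Matrix.fromRows B B' := by
    rw [Matrix.fromCols_mul_fromRows]; simp [sub_eq_add_neg]
  rw [h1, rank_mul_inj]
  · rw [Matrix.rank_eq_finrank_span_row, ← Submodule.span_union, ← Set.Sum.elim_range]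
    congr 3
    
  · intro x hx
    rw [Matrix.fromCols_mulVec] at hx
    have := hA (x ∘ Sum.inl) (x ∘ Sum.inr) (by
      rw [Matrix.neg_mulVec] at hx
      exact add_neg_eq_zero.mp hx)
    funext i
    rcases i with i | i
    · exact congrFun this.1 i
    · exact congrFun this.2 i

lemma rank_of_li {F : Type*} [Field F] {n r : ℕ} (B : Matrix (Fin r) (Fin n) F)
    (h : LinearIndependent F B.row) : B.rank = r := by
  rw [LinearIndependent.rank_matrix h, Fintype.card_fin]

/-- main reduction when a good family of column matrices exists -/
lemma family {F : Type*} [Field F] {m n r d : ℕ} (S : Set (Submodule F (Fin n → F)))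
    (hS : ∀ U ∈ S, finrank F U = r)
    (hd : ∀ U ∈ S, ∀ V ∈ S, U ≠ V → d ≤ injDist U V) (hd1 : 1 ≤ d)
    (A : Submodule F (Fin n → F) → Matrix (Fin m) (Fin r) F)
    (hA0 : ∀ U ∈ S, ∀ x, (A U).mulVec x = 0 → x = 0)
    (hA : ∀ U ∈ S, ∀ V ∈ S, U ≠ V → ∀ x y, (A U).mulVec x = (A V).mulVec y → x = 0 ∧ y = 0) :
    ∃ f : Submodule F (Fin n → F) → Matrix (Fin m) (Fin n) F,
      (∀ U ∈ S, (f U).rank = r) ∧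
      ∀ U ∈ S, ∀ V ∈ S, U ≠ V → d + r ≤ (f U - f V).rank := by
  have hB : ∀ U : Submodule F (Fin n → F), ∃ B : Matrix (Fin r) (Fin n) F, U ∈ S →
      LinearIndependent F B.row ∧ Submodule.span F (Set.range B.row) = U := by
    intro U
    by_cases h : U ∈ S
    · obtain ⟨B, hB⟩ := exists_basis_matrix U (hS U h)
      exact ⟨B, fun _ => hB⟩
    · exact ⟨0, fun h' => absurd h' h⟩
  choose B hB using hB
  refine ⟨fun U => A U * B U, ?_, ?_⟩
  · intro U hU
    show (A U * B U).rank = r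
    rw [rank_mul_inj _ _ (hA0 U hU), rank_of_li _ (hB U hU).1]
  · intro U hU V hV hUV
    show _ ≤ (A U * B U - A V * B V).rank
    rw [rank_sub_eq _ _ _ _ (hA U hU V hV hUV), (hB U hU).2, (hB V hV).2]
    have := hd U hU V hV hUV
    rw [injDist, hS U hU, hS V hV, min_self] at this
    omega

lemma exists_super {F : Type*} [Field F] {n k : ℕ} (V : Submodule F (Fin n → F))
    (h1 : finrank F V ≤ k) (h2 : k ≤ n) : ∃ W, V ≤ W ∧ finrank F W = k := by
  obtain ⟨j, rfl⟩ := Nat.exists_eq_add_of_le h1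
  clear h1
  induction j with
  | zero => exact ⟨V, le_rfl, rfl⟩
  | succ j ih =>
    obtain ⟨W, hW, hj⟩ := ih (by omega)
    have hne : W ≠ ⊤ := by
      rintro rfl
      rw [finrank_top, Module.finrank_fin_fun] at hj
      omega
    obtain ⟨v, hv⟩ : ∃ v, v ∉ W := by
      by_contra! hc
      exact hne (eq_top_iff.2 fun x _ => hc x)
    refine ⟨W ⊔ Submodule.span F {v}, hW.trans le_sup_left, ?_⟩
    have h3 := Submodule.finrank_sup_add_finrank_inf_eq W (Submodule.span F {v})
    have hv0 : v ≠ 0 := fun h => hv (h ▸ W.zero_mem)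
    have h4 : W ⊓ Submodule.span F {v} = ⊥ := by
      rw [← disjoint_iff]
      exact (Submodule.disjoint_span_singleton' hv0).2 hv
    rw [h4, finrank_bot, finrank_span_singleton hv0] at h3
    omega

lemma factor {F : Type*} [Field F] {m n k : ℕ} (X : Matrix (Fin m) (Fin n) F)
    (B : Matrix (Fin k) (Fin n) F) (h : rowSpace X ≤ Submodule.span F (Set.range B.row)) :
    ∃ A : Matrix (Fin m) (Fin k) F, X = A * B := by
  have : ∀ i, ∃ a : Fin k → F, Matrix.vecMul a B = X.row i := by
    intro i
    have h2 : X.row i ∈ LinearMap.range B.vecMulLinear := by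
      rw [range_vecMulLinear]
      apply h
      rw [rowSpace_eq]
      exact Submodule.subset_span ⟨i, rfl⟩
    exact h2
  choose a ha using this
  refine ⟨Matrix.of a, ?_⟩
  ext i j
  have := congrFun (ha i) j
  rw [Matrix.mul_apply_eq_vecMul]
  exact this.symm

/-- counting -/
lemma counting {F : Type*} [Field F] [Fintype F] {n r k : ℕ}
    (S : Set (Submodule F (Fin n → F))) (hS : ∀ U ∈ S, finrank F U = r) (hk : k ≤ r)
    (h : ∀ U ∈ S, ∀ V ∈ S, U ≠ V → finrank F ↥(U ⊓ V) < k) :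
    Nat.card S * ∏ i : Fin k, (Fintype.card F ^ r - Fintype.card F ^ i.val)
      ≤ Fintype.card F ^ (n * k) := by
  let f : (Σ U : S, {s : Fin k → U.1 // LinearIndependent F s}) → (Fin k → (Fin n → F)) :=
    fun p i => (p.2.1 i : Fin n → F)
  have hf : Function.Injective f := by
    rintro ⟨⟨U, hU⟩, s, hs⟩ ⟨⟨V, hV⟩, t, ht⟩ hst
    have hst' : ∀ i, (s i : Fin n → F) = t i := fun i => congrFun hst i
    by_cases hUV : U = V
    · subst hUV
      have : s = t := funext fun i => Subtype.ext (hst' i)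
      subst this
      rfl
    · exfalso
      have h1 := h U hU V hV hUV
      let w : Fin k → ↥(U ⊓ V) := fun i => ⟨s i, (s i).2, by
        rw [hst' i]; exact (t i).2⟩
      have hw : LinearIndependent F w := by
        have h3 : LinearIndependent F (fun i => (s i : Fin n → F)) :=
          hs.map' U.subtype (Submodule.ker_subtype U)
        exact LinearIndependent.of_comp (U ⊓ V).subtype h3
      have := hw.fintype_card_le_finrank
      rw [Fintype.card_fin] at this
      omega
  have h1 := Nat.card_le_card_of_injective f hf
  have : Finite S := inferInstance
  have := Fintype.ofFinite S
  rw [Nat.card_sigma] at h1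
  have h2 : ∀ U : S, Nat.card {s : Fin k → U.1 // LinearIndependent F s}
      = ∏ i : Fin k, (Fintype.card F ^ r - Fintype.card F ^ i.val) := by
    intro U
    have := Fintype.ofFinite U.1
    rw [card_linearIndependent (by rw [hS U.1 U.2]; exact hk), hS U.1 U.2]
  rw [Finset.sum_congr rfl (fun U _ => h2 U), Finset.sum_const, Finset.card_univ, smul_eq_mul] at h1
  rw [Nat.card_eq_fintype_card]
  refine h1.trans (le_of_eq ?_)
  rw [Nat.card_eq_fintype_card]
  simp [pow_mul]

lemma prod_bound (q r k : ℕ) (hq : 2 ≤ q) (hk : k ≤ r) :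
    q ^ (r * k) * (q ^ r - q ^ k) ≤ (∏ i : Fin k, (q ^ r - q ^ i.val)) * q ^ r := by
  induction k with
  | zero => simp
  | succ k ih =>
    have ih := ih (by omega)
    rw [Fin.prod_univ_castSucc]
    simp only [Fin.val_castSucc, Fin.val_last]
    have e : q ^ (k+1) ≤ q ^ r := Nat.pow_le_pow_right (by omega) hk
    have e' : q ^ k ≤ q ^ r := Nat.pow_le_pow_right (by omega) (by omega)
    set P := ∏ i : Fin k, (q ^ r - q ^ i.val)
    have e2 : q ^ r * (q ^ r - q ^ (k+1)) ≤ (q ^ r - q ^ k) * (q ^ r - q ^ k) := by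
      have e3 : 2 * q ^ k ≤ q ^ (k+1) := by rw [pow_succ']; exact Nat.mul_le_mul_right _ hq
      obtain ⟨c, hc⟩ := Nat.exists_eq_add_of_le e'
      have : q ^ r - q ^ (k+1) ≤ q ^ r - 2 * q ^ k := Nat.sub_le_sub_left e3 _
      refine (Nat.mul_le_mul_left _ this).trans ?_
      zify [e', e3.trans e]
      nlinarith [sq_nonneg ((q:ℤ)^k)]
    calc q ^ (r * (k+1)) * (q ^ r - q ^ (k+1))
        = q ^ (r * k) * (q ^ r * (q ^ r - q ^ (k+1))) := by ring
      _ ≤ q ^ (r * k) * ((q ^ r - q ^ k) * (q ^ r - q ^ k)) := Nat.mul_le_mul_left _ e2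
      _ = (q ^ (r * k) * (q ^ r - q ^ k)) * (q ^ r - q ^ k) := by ring
      _ ≤ (P * q ^ r) * (q ^ r - q ^ k) := Nat.mul_le_mul_right _ ih
      _ = _ := by ring

lemma prod_bound_two (q r k : ℕ) (hq : 2 ≤ q) (hk : k < r) :
    q ^ (r * k) ≤ 2 * ∏ i : Fin k, (q ^ r - q ^ i.val) := by
  have h := prod_bound q r k hq hk.le
  have e3 : 2 * q ^ k ≤ q ^ r := by
    calc 2 * q ^ k ≤ q * q ^ k := Nat.mul_le_mul_right _ hq
      _ = q ^ (k+1) := by ring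
      _ ≤ q ^ r := Nat.pow_le_pow_right (by omega) hk
  have e4 : q ^ r ≤ 2 * (q ^ r - q ^ k) := by omega
  have hp : 0 < q ^ r := by positivity
  refine Nat.le_of_mul_le_mul_right ?_ hp
  calc q ^ (r * k) * q ^ r ≤ q ^ (r * k) * (2 * (q ^ r - q ^ k)) := Nat.mul_le_mul_left _ e4
    _ = 2 * (q ^ (r * k) * (q ^ r - q ^ k)) := by ring
    _ ≤ 2 * (_ * q ^ r) := Nat.mul_le_mul_left _ h
    _ = _ := by ring

lemma prod_bound_crude (q k : ℕ) (hq : 2 ≤ q) :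
    q ^ ((k - 1) * k) ≤ ∏ i : Fin k, (q ^ k - q ^ i.val) := by
  rw [pow_mul]
  have : (q ^ (k - 1)) ^ k = ∏ i : Fin k, q ^ (k - 1) := by simp
  rw [this]
  apply Finset.prod_le_prod'
  intro i _
  have hk : i.val ≤ k - 1 := by omega
  have h1 : q ^ i.val ≤ q ^ (k - 1) := Nat.pow_le_pow_right (by omega) hk
  have h2 : q ^ k = q * q ^ (k - 1) := by
    rw [← pow_succ']; congr 1; omega
  have h3 : 2 * q ^ (k - 1) ≤ q * q ^ (k - 1) := Nat.mul_le_mul_right _ hq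
  omega

lemma case_eq {F : Type*} [Field F] {m n r : ℕ} (hnm : n ≤ m) (hr : 1 ≤ r)
    (S : Set (Submodule F (Fin n → F)))
    (hS : ∀ U ∈ S, finrank F U = r)
    (hd : ∀ U ∈ S, ∀ V ∈ S, U ≠ V → r ≤ injDist U V) :
    ∃ f : Submodule F (Fin n → F) → Matrix (Fin m) (Fin n) F,
      (∀ U ∈ S, (f U).rank = r) ∧
      ∀ U ∈ S, ∀ V ∈ S, U ≠ V → r + r ≤ (f U - f V).rank := by
  have hB : ∀ U : Submodule F (Fin n → F), ∃ B : Matrix (Fin r) (Fin n) F, U ∈ S →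
      LinearIndependent F B.row ∧ Submodule.span F (Set.range B.row) = U := by
    intro U
    by_cases h : U ∈ S
    · obtain ⟨B, hB⟩ := exists_basis_matrix U (hS U h)
      exact ⟨B, fun _ => hB⟩
    · exact ⟨0, fun h' => absurd h' h⟩
  choose B hB using hB
  let A : Submodule F (Fin n → F) → Matrix (Fin m) (Fin r) F := fun U =>
    Matrix.of fun i k => if h : i.val < n then B U k ⟨i, h⟩ else 0
  have hAv : ∀ U x j, (A U).mulVec x (Fin.castLE hnm j) = Matrix.vecMul x (B U) j := by
    intro U x j
    simp [A, Matrix.mulVec, Matrix.vecMul, dotProduct, mul_comm]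
  have hmem : ∀ U ∈ S, ∀ x, Matrix.vecMul x (B U) ∈ U := by
    intro U hU x
    have : Matrix.vecMul x (B U) ∈ LinearMap.range (B U).vecMulLinear := ⟨x, rfl⟩
    rw [range_vecMulLinear, (hB U hU).2] at this
    exact this
  have hinj : ∀ U ∈ S, ∀ x, Matrix.vecMul x (B U) = 0 → x = 0 := by
    intro U hU x hx
    have := Matrix.vecMul_injective_iff.2 (hB U hU).1
    exact this (by simpa using hx)
  refine family S hS hd hr A ?_ ?_
  · intro U hU x hx
    apply hinj U hU
    funext j
    rw [← hAv, hx]; rfl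
  · intro U hU V hV hUV x y hxy
    have h1 : Matrix.vecMul x (B U) = Matrix.vecMul y (B V) := by
      funext j
      rw [← hAv, ← hAv, hxy]
    have h2 := hd U hU V hV hUV
    rw [injDist, hS U hU, hS V hV, min_self] at h2
    have h3 := Submodule.finrank_sup_add_finrank_inf_eq U V
    rw [hS U hU, hS V hV] at h3
    have h4 : U ⊓ V = ⊥ := Submodule.finrank_eq_zero.1 (by omega)
    have h5 : Matrix.vecMul x (B U) ∈ U ⊓ V :=
      ⟨hmem U hU x, by rw [h1]; exact hmem V hV y⟩
    rw [h4, Submodule.mem_bot] at h5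
    exact ⟨hinj U hU x h5, hinj V hV y (h1 ▸ h5)⟩

lemma case_spread {F : Type*} [Field F] [Fintype F] {m n r d : ℕ} (hd1 : 1 ≤ d)
    (hr : 1 ≤ r) (hrm : 2 * r ≤ m)
    (S : Set (Submodule F (Fin n → F)))
    (hS : ∀ U ∈ S, finrank F U = r)
    (hd : ∀ U ∈ S, ∀ V ∈ S, U ≠ V → d ≤ injDist U V)
    (hcard : Nat.card S ≤ Fintype.card F ^ (m - r)) :
    ∃ f : Submodule F (Fin n → F) → Matrix (Fin m) (Fin n) F,
      (∀ U ∈ S, (f U).rank = r) ∧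
      ∀ U ∈ S, ∀ V ∈ S, U ≠ V → d + r ≤ (f U - f V).rank := by
  classical
  obtain ⟨L, _, _, _, hL⟩ := exists_field F (m - r) (by omega)
  have hLc : Fintype.card L = Fintype.card F ^ (m - r) := by
    rw [Module.card_eq_pow_finrank (K := F), hL]
  have : Fintype S := Fintype.ofFinite S
  obtain ⟨g⟩ : Nonempty (S ↪ L) := by
    apply Function.Embedding.nonempty_of_card_le
    rw [hLc, ← Nat.card_eq_fintype_card]; exact hcard
  obtain ⟨ι, hι⟩ : ∃ ι : (Fin r → F) →ₗ[F] L, Function.Injective ι := by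
    apply finrank_le_iff_exists_linearMap.1
    rw [hL, Module.finrank_fin_fun]; omega
  let e : ((Fin r → F) × L) ≃ₗ[F] (Fin m → F) := LinearEquiv.ofFinrankEq _ _ (by
    rw [Module.finrank_prod, hL, Module.finrank_fin_fun, Module.finrank_fin_fun]; omega)
  let a : Submodule F (Fin n → F) → L := fun U => if h : U ∈ S then g ⟨U, h⟩ else 0
  let T : Submodule F (Fin n → F) → ((Fin r → F) →ₗ[F] (Fin m → F)) := fun U =>
    e.toLinearMap ∘ₗ (LinearMap.prod LinearMap.id (LinearMap.mulLeft F (a U) ∘ₗ ι))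
  have hT : ∀ U x, (LinearMap.toMatrix' (T U)).mulVec x = e (x, a U * ι x) := by
    intro U x
    rw [LinearMap.toMatrix'_mulVec]
    rfl
  refine family S hS hd hd1 (fun U => LinearMap.toMatrix' (T U)) ?_ ?_
  · intro U hU x hx
    rw [hT] at hx
    have := e.map_eq_zero_iff.1 hx
    exact congrArg Prod.fst this
  · intro U hU V hV hUV x y hxy
    rw [hT, hT] at hxy
    have h1 := e.injective hxy
    have h2 : x = y := congrArg Prod.fst h1
    have h3 : a U * ι x = a V * ι y := congrArg Prod.snd h1
    subst h2
    have hne : a U ≠ a V := by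
      simp only [a, hU, hV, dite_true]
      intro h
      exact hUV (congrArg Subtype.val (g.injective h))
    have h4 : ι x = 0 := by
      have : (a U - a V) * ι x = 0 := by rw [sub_mul, h3, sub_self]
      exact (mul_eq_zero.1 this).resolve_left (sub_ne_zero.2 hne)
    have h5 : x = 0 := hι (by rw [h4, map_zero])
    exact ⟨h5, h5⟩

lemma card_le_of_dist {F : Type*} [Field F] [Fintype F] {n r d : ℕ} (hd2 : 2 ≤ d)
    (hdr : d ≤ r) (hrn : r ≤ n)
    (S : Set (Submodule F (Fin n → F)))
    (hS : ∀ U ∈ S, finrank F U = r)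
    (hd : ∀ U ∈ S, ∀ V ∈ S, U ≠ V → d ≤ injDist U V) :
    Nat.card S ≤ Fintype.card F ^ ((n - r) * (r - d + 1) + 1) := by
  have hq : 2 ≤ Fintype.card F := Fintype.one_lt_card
  set q := Fintype.card F
  set k := r - d + 1 with hk
  have h1 := counting (k := k) S hS (by omega) (by
    intro U hU V hV hUV
    have h2 := hd U hU V hV hUV
    rw [injDist, hS U hU, hS V hV, min_self] at h2
    have h3 := Submodule.finrank_sup_add_finrank_inf_eq U V
    rw [hS U hU, hS V hV] at h3
    omega)
  have h2 := prod_bound_two q r k hq (by omega)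
  have hp : 0 < q ^ (r * k) := by positivity
  refine Nat.le_of_mul_le_mul_right ?_ hp
  calc Nat.card S * q ^ (r * k) ≤ Nat.card S * (2 * _) := Nat.mul_le_mul_left _ h2
    _ = 2 * (Nat.card S * _) := by ring
    _ ≤ 2 * q ^ (n * k) := Nat.mul_le_mul_left _ h1
    _ ≤ q * q ^ (n * k) := Nat.mul_le_mul_right _ hq
    _ = q ^ ((n - r) * k + 1) * q ^ (r * k) := by
      rw [← pow_succ', ← pow_add]
      congr 1
      obtain ⟨c, rfl⟩ := Nat.exists_eq_add_of_le hrn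
      rw [Nat.add_sub_cancel_left]; ring

open Polynomial in
lemma moore {F L : Type*} [Field F] [Fintype F] [Field L] [Fintype L] [Algebra F L] {r : ℕ}
    (g : Fin r → L) (hg : LinearIndependent F g) :
    IsUnit (Matrix.of fun i k : Fin r => g k ^ (Fintype.card F ^ i.val)) := by
  classical
  have hq : 2 ≤ Fintype.card F := Fintype.one_lt_card
  rw [← Matrix.vecMul_injective_iff_isUnit]
  set M : Matrix (Fin r) (Fin r) L :=
    Matrix.of fun i k : Fin r => g k ^ (Fintype.card F ^ i.val) with hM
  suffices h : ∀ l : Fin r → L, Matrix.vecMul l M = 0 → l = 0 by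
    intro x y hxy
    have := h (x - y) (by
      rw [Matrix.sub_vecMul]; exact sub_eq_zero.2 hxy)
    exact sub_eq_zero.1 this
  intro l hl
  let φ : L →ₗ[F] L := ∑ i : Fin r, LinearMap.mulLeft F (l i) ∘ₗ
    ((FiniteField.frobeniusAlgHom F L) ^ i.val).toLinearMap
  have hφ : ∀ x, φ x = ∑ i : Fin r, l i * x ^ (Fintype.card F ^ i.val) := by
    intro x
    simp [φ, LinearMap.sum_apply, AlgHom.coe_pow, FiniteField.coe_frobeniusAlgHom, pow_iterate]
  let P : L[X] := ∑ i : Fin r, C (l i) * X ^ (Fintype.card F ^ i.val)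
  have hP : ∀ x, P.eval x = φ x := by
    intro x
    rw [hφ]; simp [P, eval_finsetSum]
  have hdeg : P.degree < (Fintype.card F ^ r : ℕ) := by
    refine (degree_sum_le _ _).trans_lt ?_
    rw [Finset.sup_lt_iff (WithBot.bot_lt_coe _)]
    intro i _
    refine (degree_C_mul_X_pow_le _ _).trans_lt ?_
    exact_mod_cast Nat.pow_lt_pow_right hq i.2
  let ψ : (Fin r → F) → L := fun x => ∑ k, x k • g k
  have hψ : Function.Injective ψ := by
    intro x y hxy
    have h0 : ∑ k, (x k - y k) • g k = 0 := by
      simp only [sub_smul, Finset.sum_sub_distrib]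
      exact sub_eq_zero.2 hxy
    funext k
    exact sub_eq_zero.1 (Fintype.linearIndependent_iff.1 hg _ h0 k)
  have hzero : P = 0 := by
    refine eq_zero_of_degree_lt_of_eval_finset_eq_zero (s := Finset.univ.image ψ) ?_ ?_
    · rw [Finset.card_image_of_injective _ hψ]
      simpa using hdeg
    · intro x hx
      obtain ⟨c, _, rfl⟩ := Finset.mem_image.1 hx
      rw [hP]
      simp only [ψ, map_sum, map_smul]
      apply Finset.sum_eq_zero
      intro k _
      have : φ (g k) = 0 := by
        rw [hφ]
        exact congrFun hl k
      rw [this, smul_zero]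
  funext i
  have := congrArg (fun p => p.coeff (Fintype.card F ^ i.val)) hzero
  simp only [P, finsetSum_coeff, coeff_C_mul, coeff_X_pow, coeff_zero] at this
  rw [Finset.sum_eq_single i] at this
  · simpa using this
  · intro j _ hj
    rw [if_neg, mul_zero]
    intro h
    exact hj (Fin.ext (Nat.pow_right_injective hq h).symm)
  · simp

section Gab

/-- the word over the extension field attached to a matrix -/
noncomputable def cw {F L : Type*} [Field F] [Field L] [Algebra F L] {m k : ℕ}
    (β : Basis (Fin m) F L) (A : Matrix (Fin m) (Fin k) F) : Fin k → L :=
  fun l => ∑ t, A t l • β t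

/-- the syndrome of a matrix -/
noncomputable def syn {F L : Type*} [Field F] [Fintype F] [Field L] [Algebra F L] {m n : ℕ} (r : ℕ)
    (β : Basis (Fin m) F L) (h : Fin n → L) (X : Matrix (Fin m) (Fin n) F) : Fin r → L :=
  fun i => ∑ j, h j ^ (Fintype.card F ^ i.val) * cw β X j

/-- combination of the `h j` given by a row of `B` -/
noncomputable def gg {F L : Type*} [Field F] [Field L] [Algebra F L] {n k : ℕ}
    (h : Fin n → L) (B : Matrix (Fin k) (Fin n) F) : Fin k → L :=
  fun l => ∑ j, B l j • h j

variable {F L : Type*} [Field F] [Fintype F] [Field L] [Fintype L] [Algebra F L] {m n k r : ℕ}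

lemma gg_pow (h : Fin n → L) (B : Matrix (Fin k) (Fin n) F) (l : Fin k) (i : ℕ) :
    gg h B l ^ (Fintype.card F ^ i) = ∑ j, B l j • h j ^ (Fintype.card F ^ i) := by
  have key : ∀ x : L, ((FiniteField.frobeniusAlgHom F L) ^ i) x = x ^ (Fintype.card F ^ i) := by
    intro x
    simp [AlgHom.coe_pow, FiniteField.coe_frobeniusAlgHom, pow_iterate]
  rw [← key, gg, map_sum]
  exact Finset.sum_congr rfl fun j _ => by rw [map_smul, key]

lemma gg_li (h : Fin n → L) (hh : LinearIndependent F h) (B : Matrix (Fin k) (Fin n) F)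
    (hB : LinearIndependent F B.row) : LinearIndependent F (gg h B) := by
  have h1 := hB.map' (Fintype.linearCombination F h) (by
    rw [LinearMap.ker_eq_bot']
    intro x hx
    funext j
    exact Fintype.linearIndependent_iff.1 hh x hx j)
  exact h1

lemma syn_mul (β : Basis (Fin m) F L) (h : Fin n → L) (A : Matrix (Fin m) (Fin k) F)
    (B : Matrix (Fin k) (Fin n) F) (i : Fin r) :
    syn r β h (A * B) i = ∑ l, gg h B l ^ (Fintype.card F ^ i.val) * cw β A l := by
  simp only [gg_pow, syn, cw, Matrix.mul_apply, Finset.sum_smul, Finset.sum_mul, Finset.mul_sum]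
  have e : ∀ (j : Fin n) , (∑ t, ∑ l, h j ^ (Fintype.card F ^ i.val) * ((A t l * B l j) • β t))
      = ∑ l, ∑ t, h j ^ (Fintype.card F ^ i.val) * ((A t l * B l j) • β t) :=
    fun j => Finset.sum_comm
  rw [Finset.sum_congr rfl fun j _ => e j, Finset.sum_comm]
  refine Finset.sum_congr rfl fun l _ => ?_
  rw [Finset.sum_comm]
  refine Finset.sum_congr rfl fun t _ => Finset.sum_congr rfl fun j _ => ?_
  simp only [Algebra.smul_def, map_mul]
  ring

lemma syn_sub (β : Basis (Fin m) F L) (h : Fin n → L) (X Y : Matrix (Fin m) (Fin n) F) :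
    syn r β h (X - Y) = syn r β h X - syn r β h Y := by
  funext i
  simp [syn, cw, sub_smul, mul_sub, Finset.sum_sub_distrib]

lemma cw_surj (β : Basis (Fin m) F L) (c : Fin k → L) :
    ∃ A : Matrix (Fin m) (Fin k) F, cw β A = c := by
  refine ⟨Matrix.of fun t l => β.repr (c l) t, ?_⟩
  funext l
  simp only [cw, Matrix.of_apply]
  exact β.sum_repr (c l)

lemma cw_inj (β : Basis (Fin m) F L) (A : Matrix (Fin m) (Fin k) F) (hA : cw β A = 0) : A = 0 := by
  ext t l
  exact Fintype.linearIndependent_iff.1 β.linearIndependent (fun t => A t l) (congrFun hA l) t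

lemma syn_mul' (β : Basis (Fin m) F L) (h : Fin n → L) (A : Matrix (Fin m) (Fin k) F)
    (B : Matrix (Fin k) (Fin n) F) :
    syn r β h (A * B) = (Matrix.of fun (i : Fin r) (l : Fin k) =>
      gg h B l ^ (Fintype.card F ^ i.val)).mulVec (cw β A) := by
  funext i
  rw [syn_mul]; rfl

lemma syn_inj (β : Basis (Fin m) F L) (h : Fin n → L) (hh : LinearIndependent F h) (hrn : r ≤ n)
    (X : Matrix (Fin m) (Fin n) F) (hX : X.rank ≤ r) (h0 : syn r β h X = 0) : X = 0 := by
  rw [rank_eq_rowSpace] at hX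
  obtain ⟨W, hW, hWr⟩ := exists_super _ hX hrn
  obtain ⟨B, hB, hBW⟩ := exists_basis_matrix W hWr
  obtain ⟨A, rfl⟩ := factor X B (by rw [hBW]; exact hW)
  rw [syn_mul'] at h0
  have hu := moore (gg h B) (gg_li h hh B hB)
  have : cw β A = 0 := Matrix.mulVec_injective_of_isUnit hu (by rw [h0, Matrix.mulVec_zero])
  rw [cw_inj β A this, Matrix.zero_mul]

lemma exists_good (β : Basis (Fin m) F L) (h : Fin n → L) (hr : 1 ≤ r) (h2r : 2 * r ≤ n)
    (hm : (n - r) * r + r + 1 ≤ m) :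
    ∃ s : Fin r → L, ∀ X : Matrix (Fin m) (Fin n) F, X.rank < r → syn r β h X ≠ s := by
  classical
  have hq : 2 ≤ Fintype.card F := Fintype.one_lt_card
  obtain ⟨k, rfl⟩ : ∃ k, r = k + 1 := ⟨r - 1, by omega⟩
  let S : Set (Submodule F (Fin n → F)) := {W | finrank F W = k}
  have hcount := counting (k := k) (r := k) S (fun _ hU => hU) le_rfl (by
    intro U hU V hV hUV
    by_contra! hc
    have h1 : U ⊓ V = U := Submodule.eq_of_le_of_finrank_le inf_le_left (by rw [hU]; exact hc)
    have h2 : U ⊓ V = V := Submodule.eq_of_le_of_finrank_le inf_le_right (by rw [hV]; exact hc)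
    exact hUV (h1.symm.trans h2))
  have hcr := prod_bound_crude (Fintype.card F) k hq
  choose B hB using fun W : S => exists_basis_matrix W.1 W.2
  let G : S × (Fin k → L) → (Fin (k+1) → L) := fun p =>
    (Matrix.of fun (i : Fin (k+1)) (l : Fin k) =>
      gg h (B p.1) l ^ (Fintype.card F ^ i.val)).mulVec p.2
  have hG : ¬ Function.Surjective G := by
    intro hs
    have hle := Nat.card_le_card_of_surjective G hs
    have hL : Nat.card L = Fintype.card F ^ m := by
      rw [Nat.card_eq_fintype_card, Module.card_eq_pow_finrank (K := F),
        Module.finrank_eq_card_basis β, Fintype.card_fin]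
    rw [Nat.card_prod, Nat.card_fun, Nat.card_fun, hL, Nat.card_fin, Nat.card_fin,
      ← pow_mul, ← pow_mul] at hle
    set q := Fintype.card F
    have h1 : Nat.card S * q ^ ((k - 1) * k) ≤ q ^ (n * k) :=
      (Nat.mul_le_mul_left _ hcr).trans hcount
    have h2 : q ^ (m * (k+1) + (k-1) * k) ≤ q ^ (n * k + m * k) := by
      calc q ^ (m * (k+1) + (k-1) * k) = q ^ (m * (k+1)) * q ^ ((k-1) * k) := pow_add _ _ _
        _ ≤ (Nat.card S * q ^ (m * k)) * q ^ ((k-1) * k) := Nat.mul_le_mul_right _ hle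
        _ = (Nat.card S * q ^ ((k-1) * k)) * q ^ (m * k) := by ring
        _ ≤ q ^ (n * k) * q ^ (m * k) := Nat.mul_le_mul_right _ h1
        _ = _ := (pow_add _ _ _).symm
    have h3 := (Nat.pow_le_pow_iff_right (by omega)).1 h2
    obtain ⟨c, rfl⟩ := Nat.exists_eq_add_of_le h2r
    have h4 : 2 * (k+1) + c - (k+1) = k + 1 + c := by omega
    rw [h4] at hm
    rcases k with _ | k
    · simp at h3 hm; omega
    · simp only [Nat.add_sub_cancel] at h3
      nlinarith
  rw [Function.Surjective] at hG
  push Not at hG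
  obtain ⟨s, hs⟩ := hG
  refine ⟨s, fun X hX hXs => ?_⟩
  have hX' : finrank F (rowSpace X) ≤ k := by rw [← rank_eq_rowSpace]; omega
  obtain ⟨W, hW, hWr⟩ := exists_super _ hX' (by omega)
  obtain ⟨A, hA⟩ := factor X (B ⟨W, hWr⟩) (by rw [(hB ⟨W, hWr⟩).2]; exact hW)
  apply hs (⟨W, hWr⟩, cw β A)
  rw [← hXs, hA, syn_mul']

end Gab

lemma case_one {F : Type*} [Field F] [Fintype F] {m n r : ℕ} (hr : 1 ≤ r) (h2r : 2 * r ≤ n)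
    (hnm : n ≤ m) (hm : (n - r) * r + r + 1 ≤ m)
    (S : Set (Submodule F (Fin n → F)))
    (hS : ∀ U ∈ S, finrank F U = r) :
    ∃ f : Submodule F (Fin n → F) → Matrix (Fin m) (Fin n) F,
      (∀ U ∈ S, (f U).rank = r) ∧
      ∀ U ∈ S, ∀ V ∈ S, U ≠ V → 1 + r ≤ (f U - f V).rank := by
  obtain ⟨L, _, _, _, hL⟩ := exists_field F m (by omega)
  let β : Basis (Fin m) F L := finBasisOfFinrankEq F L hL
  let h : Fin n → L := fun j => β (Fin.castLE hnm j)
  have hh : LinearIndependent F h :=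
    β.linearIndependent.comp _ (Fin.castLE_injective hnm)
  obtain ⟨s, hs⟩ := exists_good β h hr h2r hm
  have key : ∀ U : Submodule F (Fin n → F), ∃ X : Matrix (Fin m) (Fin n) F, U ∈ S →
      X.rank = r ∧ rowSpace X = U ∧ syn r β h X = s := by
    intro U
    by_cases hU : U ∈ S
    swap
    · exact ⟨0, fun h' => absurd h' hU⟩
    obtain ⟨B, hB, hBU⟩ := exists_basis_matrix U (hS U hU)
    have hu := moore (gg h B) (gg_li h hh B hB)
    obtain ⟨c, hc⟩ := Matrix.mulVec_surjective_iff_isUnit.2 hu s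
    obtain ⟨A, hA⟩ := cw_surj β c
    have hsyn : syn r β h (A * B) = s := by rw [syn_mul', hA]; exact hc
    have hrk : (A * B).rank = r := by
      refine le_antisymm ?_ (not_lt.1 fun hlt => hs _ hlt hsyn)
      refine (Matrix.rank_mul_le_right A B).trans (rank_of_li B hB).le
    refine ⟨A * B, fun _ => ⟨hrk, ?_, hsyn⟩⟩
    refine Submodule.eq_of_le_of_finrank_le ?_ ?_
    · rw [← hBU, rowSpace, ← range_vecMulLinear]
      rintro _ ⟨x, rfl⟩
      exact ⟨Matrix.vecMul x A, by simp [Matrix.vecMul_vecMul]⟩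
    · rw [← rank_eq_rowSpace, hrk, hS U hU]
  choose f hf using key
  refine ⟨f, fun U hU => (hf U hU).1, fun U hU V hV hUV => ?_⟩
  by_contra! hc
  apply hUV
  have := syn_inj β h hh (r := r) (by omega) (f U - f V) (by omega) (by
    rw [syn_sub, (hf U hU).2.2, (hf V hV).2.2, sub_self])
  rw [← (hf U hU).2.1, ← (hf V hV).2.1, sub_eq_zero.1 this]

end Stmt5Aux

open Stmt5Aux

theorem stmt5 {q m n d r : ℕ} (F : Type*) [Field F] [Fintype F] (hF : Fintype.card F = q)
    (h2r : 2 * r ≤ n) (hnm : n ≤ m) (hd1 : 1 ≤ d) (hdr : d ≤ r)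
    (hcase : d = r ∨ (n - r) * (r - d + 1) + r + 1 ≤ m) :
    A_R F m n (d + r) r = A_C F n r d := by
  unfold A_R A_C maxRankCode
  congr 1
  ext c
  constructor
  · rintro ⟨C, hne, hrk, hdist, hc⟩
    have hrk' : ∀ X ∈ C, finrank F (rowSpace X) = r := fun X hX => by
      rw [← rank_eq_rowSpace]; exact hrk X hX
    have key : ∀ X ∈ C, ∀ Y ∈ C, X ≠ Y → d + r ≤ finrank F ↥(rowSpace X ⊔ rowSpace Y) := by
      intro X hX Y hY hXY
      refine (hdist X hX Y hY hXY).trans ?_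
      rw [rank_eq_rowSpace]
      apply Submodule.finrank_mono
      rintro _ ⟨x, rfl⟩
      have : (X - Y).vecMulLinear x = X.vecMulLinear x - Y.vecMulLinear x := by
        simp [Matrix.vecMul_sub]
      rw [this]
      exact Submodule.sub_mem _ (Submodule.mem_sup_left ⟨x, rfl⟩)
        (Submodule.mem_sup_right ⟨x, rfl⟩)
    refine ⟨rowSpace '' C, hne.image _, ?_, ?_, ?_⟩
    · rintro _ ⟨X, hX, rfl⟩
      exact hrk' X hX
    · rintro _ ⟨X, hX, rfl⟩ _ ⟨Y, hY, rfl⟩ hXY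
      have := key X hX Y hY (fun h => hXY (by rw [h]))
      rw [injDist, hrk' X hX, hrk' Y hY, min_self]
      omega
    · rw [Set.InjOn.ncard_image, hc]
      intro X hX Y hY hXY
      by_contra hne
      have h1 := key X hX Y hY hne
      have h2 : rowSpace X = rowSpace Y := hXY
      rw [h2, sup_idem, hrk' Y hY] at h1
      omega
  · rintro ⟨S, hne, hS, hd, hc⟩
    obtain ⟨f, hf1, hf2⟩ : ∃ f : Submodule F (Fin n → F) → Matrix (Fin m) (Fin n) F,
        (∀ U ∈ S, (f U).rank = r) ∧
        ∀ U ∈ S, ∀ V ∈ S, U ≠ V → d + r ≤ (f U - f V).rank := by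
      rcases hcase with rfl | hm
      · exact case_eq hnm hd1 S hS hd
      · by_cases h1 : d = 1
        · subst h1
          rw [Nat.sub_add_cancel hdr] at hm
          exact case_one hdr h2r hnm hm S hS
        · refine case_spread hd1 (by omega) (by omega) S hS hd ?_
          refine (card_le_of_dist (by omega) hdr (by omega) S hS hd).trans ?_
          exact Nat.pow_le_pow_right Fintype.card_pos (by omega)
    refine ⟨f '' S, hne.image _, ?_, ?_, ?_⟩
    · rintro _ ⟨U, hU, rfl⟩
      exact hf1 U hU
    · rintro _ ⟨U, hU, rfl⟩ _ ⟨V, hV, rfl⟩ hUV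
      exact hf2 U hU V hV (fun h => hUV (by rw [h]))
    · rw [Set.InjOn.ncard_image, hc]
      intro U hU V hV hUV
      by_contra hne
      have h1 := hf2 U hU V hV hne
      have h2 : f U = f V := hUV
      rw [h2, sub_self, Matrix.rank_zero] at h1
      omega
end

section
/- (Gilbert-type bound) Let q be a prime power, 1 ≤ r, d ≤ n ≤ m, and let Y be any fixed m×n matrix over GF(q) of rank r. Then A_R(q,m,n,d,r) · |{Z ∈ GF(q)^{m×n} : rank(Z) = r and rank(Z − Y) ≤ d − 1}| ≥ N_R(q,m,n,r). -/
open Module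

theorem equiv_of_finrank_range_eq {F V W : Type*} [Field F] [AddCommGroup V] [Module F V]
    [AddCommGroup W] [Module F W] [FiniteDimensional F V] [FiniteDimensional F W]
    (f g : V →ₗ[F] W) (h : finrank F (LinearMap.range f) = finrank F (LinearMap.range g)) :
    ∃ (e : V ≃ₗ[F] V) (e' : W ≃ₗ[F] W), ∀ v, g (e v) = e' (f v) := by
  obtain ⟨Cf, hCf⟩ := Submodule.exists_isCompl (LinearMap.ker f)
  obtain ⟨Cg, hCg⟩ := Submodule.exists_isCompl (LinearMap.ker g)
  obtain ⟨Rf, hRf⟩ := Submodule.exists_isCompl (LinearMap.range f)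
  obtain ⟨Rg, hRg⟩ := Submodule.exists_isCompl (LinearMap.range g)
  have h1 := f.finrank_range_add_finrank_ker
  have h2 := g.finrank_range_add_finrank_ker
  have h3 := Submodule.finrank_add_eq_of_isCompl hCf
  have h4 := Submodule.finrank_add_eq_of_isCompl hCg
  have h5 := Submodule.finrank_add_eq_of_isCompl hRf
  have h6 := Submodule.finrank_add_eq_of_isCompl hRg
  let a : LinearMap.ker f ≃ₗ[F] LinearMap.ker g := LinearEquiv.ofFinrankEq _ _ (by omega)
  let c : Cf ≃ₗ[F] Cg := LinearEquiv.ofFinrankEq _ _ (by omega)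
  let s : Rf ≃ₗ[F] Rg := LinearEquiv.ofFinrankEq _ _ (by omega)
  let kf := f.kerComplementEquivRange hCf.symm
  let kg := g.kerComplementEquivRange hCg.symm
  let b : LinearMap.range f ≃ₗ[F] LinearMap.range g := kf.symm ≪≫ₗ c ≪≫ₗ kg
  let pf := Submodule.prodEquivOfIsCompl _ _ hCf
  let pg := Submodule.prodEquivOfIsCompl _ _ hCg
  let rf := Submodule.prodEquivOfIsCompl _ _ hRf
  let rg := Submodule.prodEquivOfIsCompl _ _ hRg
  refine ⟨pf.symm ≪≫ₗ (a.prodCongr c) ≪≫ₗ pg, rf.symm ≪≫ₗ (b.prodCongr s) ≪≫ₗ rg, ?_⟩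
  intro v
  obtain ⟨⟨k, x⟩, rfl⟩ := pf.surjective v
  have hf : f (pf (k, x)) = rf (kf x, 0) := by
    simp [pf, rf, kf]
  rw [hf]
  simp [pf, pg, rg, b, kg]

theorem exists_rank_preserving {F : Type*} [Field F] {m n : ℕ}
    (X Y : Matrix (Fin m) (Fin n) F) (h : X.rank = Y.rank) :
    ∃ Φ : Matrix (Fin m) (Fin n) F → Matrix (Fin m) (Fin n) F,
      (∀ M N, Φ (M - N) = Φ M - Φ N) ∧ (∀ M, (Φ M).rank = M.rank) ∧ Φ X = Y := by
  obtain ⟨e, e', he⟩ := equiv_of_finrank_range_eq X.mulVecLin Y.mulVecLin h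
  refine ⟨fun M => LinearMap.toMatrix' (e'.toLinearMap ∘ₗ M.mulVecLin ∘ₗ e.symm.toLinearMap),
    ?_, ?_, ?_⟩
  · intro M N
    rw [← map_sub]
    congr 1
    ext v
    simp [Matrix.sub_mulVec]
  · intro M
    unfold Matrix.rank
    rw [← Matrix.toLin'_apply', Matrix.toLin'_toMatrix', LinearMap.range_comp,
      LinearMap.range_comp, LinearEquiv.range, Submodule.map_top]
    exact LinearEquiv.finrank_map_eq e' _
  · have : e'.toLinearMap ∘ₗ X.mulVecLin ∘ₗ e.symm.toLinearMap = Matrix.toLin' Y := by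
      apply LinearMap.ext
      intro v
      have := he (e.symm v)
      simp only [LinearEquiv.apply_symm_apply] at this
      simpa using this.symm
    simp only [this, LinearMap.toMatrix'_toLin']

theorem rank_eq_zero_imp {F : Type*} [Field F] {m n : ℕ}
    (X : Matrix (Fin m) (Fin n) F) (h : X.rank = 0) : X = 0 := by
  unfold Matrix.rank at h
  rw [Submodule.finrank_eq_zero, LinearMap.range_eq_bot, ← Matrix.toLin'_apply'] at h
  exact Matrix.toLin'.map_eq_zero_iff.mp h

theorem my_rank_neg {F : Type*} [Field F] {m n : ℕ}
    (X : Matrix (Fin m) (Fin n) F) : (-X).rank = X.rank := by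
  unfold Matrix.rank
  have : (-X).mulVecLin = -X.mulVecLin := by
    rw [← Matrix.toLin'_apply', ← Matrix.toLin'_apply', map_neg]
  rw [this, LinearMap.range_neg]

theorem ball_card_le {F : Type*} [Field F] [Fintype F] {m n : ℕ} (r d : ℕ)
    (X Y : Matrix (Fin m) (Fin n) F) (h : X.rank = Y.rank) :
    {Z : Matrix (Fin m) (Fin n) F | Z.rank = r ∧ (Z - X).rank ≤ d - 1}.ncard ≤
    {Z : Matrix (Fin m) (Fin n) F | Z.rank = r ∧ (Z - Y).rank ≤ d - 1}.ncard := by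
  obtain ⟨Φ, h1, h2, h3⟩ := exists_rank_preserving X Y h
  refine Set.ncard_le_ncard_of_injOn Φ ?_ ?_ (Set.toFinite _)
  · rintro Z ⟨hZ, hZX⟩
    refine ⟨(h2 Z).trans hZ, ?_⟩
    rw [← h3, ← h1, h2]
    exact hZX
  · intro M _ N _ hMN
    have : (M - N).rank = 0 := by rw [← h2, h1, hMN, sub_self, Matrix.rank_zero]
    exact sub_eq_zero.mp (rank_eq_zero_imp _ this)

theorem stmt7 {q m n d r : ℕ} (F : Type*) [Field F] [Fintype F] (hF : Fintype.card F = q)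
    (hr1 : 1 ≤ r) (hd1 : 1 ≤ d) (hrn : r ≤ n) (hdn : d ≤ n) (hnm : n ≤ m)
    (Y : Matrix (Fin m) (Fin n) F) (hY : Y.rank = r) :
    N_R F m n r ≤ A_R F m n d r *
      Nat.card {Z : Matrix (Fin m) (Fin n) F // Z.rank = r ∧ (Z - Y).rank ≤ d - 1} := by
  classical
  set S := {c : ℕ | ∃ C : Set (Matrix (Fin m) (Fin n) F), C.Nonempty ∧
    (∀ X ∈ C, X.rank ∈ ({r} : Set ℕ)) ∧
    (∀ X ∈ C, ∀ Y ∈ C, X ≠ Y → d ≤ (X - Y).rank) ∧ C.ncard = c} with hS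
  have hA : A_R F m n d r = sSup S := rfl
  have hbdd : BddAbove S := by
    refine ⟨Nat.card (Matrix (Fin m) (Fin n) F), ?_⟩
    rintro c ⟨C, -, -, -, rfl⟩
    exact Set.ncard_le_card C
  have hne : S.Nonempty := by
    refine ⟨_, {Y}, Set.singleton_nonempty _, ?_, ?_, rfl⟩
    · rintro X rfl
      exact hY
    · rintro X rfl Z rfl h
      exact absurd rfl h
  obtain ⟨C, hC1, hC2, hC3, hC4⟩ := Nat.sSup_mem hne hbdd
  have hcov : ∀ Z : Matrix (Fin m) (Fin n) F, Z.rank = r → ∃ X ∈ C, (Z - X).rank ≤ d - 1 := by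
    intro Z hZ
    by_contra! hcon
    have hZC : Z ∉ C := by
      intro hmem
      have := hcon Z hmem
      rw [sub_self, Matrix.rank_zero] at this
      omega
    have hmem : (insert Z C).ncard ∈ S := by
      refine ⟨insert Z C, Set.insert_nonempty _ _, ?_, ?_, rfl⟩
      · rintro X (rfl | hX)
        · exact hZ
        · exact hC2 X hX
      · rintro X (rfl | hX) W (rfl | hW) hne
        · exact absurd rfl hne
        · have := hcon W hW
          omega
        · have := hcon X hX
          rw [← neg_sub, my_rank_neg] at this
          omega
        · exact hC3 X hX W hW hne
    have h1 := le_csSup hbdd hmem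
    rw [Set.ncard_insert_of_notMem hZC (Set.toFinite _), hC4] at h1
    omega
  rw [hA, ← hC4]
  let B : Matrix (Fin m) (Fin n) F → Finset (Matrix (Fin m) (Fin n) F) := fun X =>
    {Z | Z.rank = r ∧ (Z - X).rank ≤ d - 1}
  have hB : ∀ X, {Z : Matrix (Fin m) (Fin n) F | Z.rank = r ∧ (Z - X).rank ≤ d - 1}.ncard
      = (B X).card := by
    intro X
    rw [← Set.ncard_coe_finset]
    simp [B]
  have hN : N_R F m n r = ({X | X.rank = r} : Finset (Matrix (Fin m) (Fin n) F)).card := by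
    rw [← Set.ncard_coe_finset]
    rw [← Nat.card_coe_set_eq, Finset.coe_filter_univ]
    rfl
  have hBY : Nat.card {Z : Matrix (Fin m) (Fin n) F // Z.rank = r ∧ (Z - Y).rank ≤ d - 1}
      = (B Y).card := by
    rw [← hB, ← Nat.card_coe_set_eq]
    rfl
  rw [hN, hBY, Set.ncard_eq_toFinset_card']
  refine le_trans (Finset.card_le_card ?_) (Finset.card_biUnion_le_card_mul C.toFinset B _ ?_)
  · intro Z hZ
    obtain ⟨X, hX, hZX⟩ := hcov Z (by simpa using hZ)
    simp only [Finset.mem_biUnion, Set.mem_toFinset]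
    refine ⟨X, hX, ?_⟩
    simp only [B, Finset.mem_filter, Finset.mem_univ, true_and]
    exact ⟨by simpa using hZ, hZX⟩
  · intro X hX
    rw [← hB, ← hB]
    apply ball_card_le
    have := hC2 X (by simpa using hX)
    rw [hY]
    exact this
end

section
/- (Johnson bound for rank metric codes) Let q be a prime power and 1 ≤ r < n ≤ m, 1 ≤ d < n. Then (q^{n−r} − 1) · A_R(q,m,n,d,r) ≤ (q^n − 1) · A_R(q,m,n−1,d,r). -/
open Module

theorem rank_mul_aux {F : Type*} [Field F] {m n : ℕ} (v : Fin n → F) (hv : v ≠ 0) :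
    ∃ P : Matrix (Fin n) (Fin (n - 1)) F, ∀ X : Matrix (Fin m) (Fin n) F,
      X.mulVec v = 0 → (X * P).rank = X.rank := by
  classical
  obtain ⟨W, hW⟩ := Submodule.exists_isCompl (Submodule.span F {v})
  have h1 : finrank F W = n - 1 := by
    have := Submodule.finrank_add_eq_of_isCompl hW
    rw [finrank_span_singleton hv] at this
    simp at this
    omega
  have h2 : finrank F (Fin (n - 1) → F) = finrank F W := by simp [h1]
  let e : (Fin (n - 1) → F) ≃ₗ[F] W := LinearEquiv.ofFinrankEq _ _ h2
  refine ⟨LinearMap.toMatrix' (W.subtype ∘ₗ e.toLinearMap), fun X hX => ?_⟩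
  have h3 : LinearMap.range (X * LinearMap.toMatrix' (W.subtype ∘ₗ e.toLinearMap)).mulVecLin
      = LinearMap.range X.mulVecLin := by
    rw [Matrix.mulVecLin_mul, LinearMap.range_comp]
    have : LinearMap.range (LinearMap.toMatrix' (W.subtype ∘ₗ e.toLinearMap)).mulVecLin = W := by
      rw [← Matrix.toLin'_apply', Matrix.toLin'_toMatrix', LinearMap.range_comp]
      simp
    rw [this, LinearMap.range_eq_map, ← hW.sup_eq_top, Submodule.map_sup]
    have h0 : Submodule.map X.mulVecLin (Submodule.span F {v}) = ⊥ := by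
      rw [Submodule.map_span]
      simp [hX]
    rw [h0, bot_sup_eq]
  unfold Matrix.rank
  rw [h3]

theorem bdd_aux (F : Type*) [Field F] [Fintype F] (m n d : ℕ) (I : Set ℕ) :
    BddAbove {c : ℕ | ∃ C : Set (Matrix (Fin m) (Fin n) F), C.Nonempty ∧
    (∀ X ∈ C, X.rank ∈ I) ∧
    (∀ X ∈ C, ∀ Y ∈ C, X ≠ Y → d ≤ (X - Y).rank) ∧ C.ncard = c} := by
  classical
  refine ⟨Nat.card (Matrix (Fin m) (Fin n) F), ?_⟩
  rintro c ⟨C, -, -, -, rfl⟩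
  exact Set.ncard_le_card C

theorem card_ker_aux {F : Type*} [Field F] [Fintype F] {m n r : ℕ}
    (X : Matrix (Fin m) (Fin n) F) (h : X.rank = r) :
    {v : Fin n → F | v ≠ 0 ∧ X.mulVec v = 0}.ncard = Fintype.card F ^ (n - r) - 1 := by
  classical
  have h1 := LinearMap.finrank_range_add_finrank_ker X.mulVecLin
  have h2 : finrank F (LinearMap.ker X.mulVecLin) = n - r := by
    change X.rank + _ = _ at h1
    simp at h1
    omega
  have h3 : Nat.card (LinearMap.ker X.mulVecLin) = Fintype.card F ^ (n - r) := by
    rw [Module.natCard_eq_pow_finrank (K := F), h2, Nat.card_eq_fintype_card]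
  have h4 : {v : Fin n → F | v ≠ 0 ∧ X.mulVec v = 0}
      = (LinearMap.ker X.mulVecLin : Set (Fin n → F)) \ {0} := by
    ext v
    simp [and_comm]
  rw [h4, Set.ncard_sdiff_singleton_of_mem (by simp), ← h3]
  rfl

theorem code_aux {F : Type*} [Field F] [Fintype F] {m n d r : ℕ}
    (C : Set (Matrix (Fin m) (Fin n) F)) (hC : ∀ X ∈ C, X.rank = r)
    (hd : ∀ X ∈ C, ∀ Y ∈ C, X ≠ Y → d ≤ (X - Y).rank) (v : Fin n → F) (hv : v ≠ 0) :
    {X ∈ C | X.mulVec v = 0}.ncard ≤ A_R F m (n - 1) d r := by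
  classical
  obtain ⟨P, hP⟩ := rank_mul_aux (m := m) v hv
  rcases Set.eq_empty_or_nonempty {X ∈ C | X.mulVec v = 0} with h | h
  · simp [h]
  have hdiff : ∀ X ∈ {X ∈ C | X.mulVec v = 0}, ∀ Y ∈ {X ∈ C | X.mulVec v = 0},
      (X * P - Y * P).rank = (X - Y).rank := by
    rintro X ⟨-, hX⟩ Y ⟨-, hY⟩
    rw [← Matrix.sub_mul]
    exact hP _ (by rw [Matrix.sub_mulVec, hX, hY, sub_zero])
  have hinj : Set.InjOn (fun X => X * P) {X ∈ C | X.mulVec v = 0} := by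
    intro X hX Y hY hXY
    have h1 := hdiff X hX Y hY
    have h2 : X * P = Y * P := hXY
    rw [h2, sub_self, Matrix.rank_zero] at h1
    have h3 : LinearMap.range (X - Y).mulVecLin = ⊥ := Submodule.finrank_eq_zero.mp h1.symm
    have h4 : Matrix.toLin' (X - Y) = 0 := LinearMap.range_eq_bot.mp h3
    exact sub_eq_zero.mp ((LinearEquiv.map_eq_zero_iff _).mp h4)
  refine le_csSup (bdd_aux F m (n - 1) d {r})
    ⟨(fun X => X * P) '' {X ∈ C | X.mulVec v = 0}, h.image _, ?_, ?_, hinj.ncard_image⟩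
  · rintro _ ⟨X, hX, rfl⟩
    exact (hP X hX.2).trans (hC X hX.1)
  · rintro _ ⟨X, hX, rfl⟩ _ ⟨Y, hY, rfl⟩ hne
    change d ≤ (X * P - Y * P).rank
    rw [hdiff X hX Y hY]
    exact hd X hX.1 Y hY.1 (fun h => hne (by rw [h]))

theorem stmt9 {q m n d r : ℕ} (F : Type*) [Field F] [Fintype F] (hF : Fintype.card F = q)
    (hr1 : 1 ≤ r) (hrn : r < n) (hd1 : 1 ≤ d) (hdn : d < n) (hnm : n ≤ m) :
    (q ^ (n - r) - 1) * A_R F m n d r ≤ (q ^ n - 1) * A_R F m (n - 1) d r := by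
  classical
  rcases Set.eq_empty_or_nonempty {c : ℕ | ∃ C : Set (Matrix (Fin m) (Fin n) F), C.Nonempty ∧
    (∀ X ∈ C, X.rank ∈ ({r} : Set ℕ)) ∧
    (∀ X ∈ C, ∀ Y ∈ C, X ≠ Y → d ≤ (X - Y).rank) ∧ C.ncard = c} with h | h
  · have : A_R F m n d r = 0 := by
      unfold A_R maxRankCode
      rw [h]
      simp
    simp [this]
  obtain ⟨C, -, hC, hd, hcard⟩ := Nat.sSup_mem h (bdd_aux F m n d {r})
  change C.ncard = A_R F m n d r at hcard
  rw [← hcard, ← hF]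
  have hfin : C.Finite := Set.toFinite C
  let S : Finset (Matrix (Fin m) (Fin n) F) := hfin.toFinset
  let T : Finset (Fin n → F) := Finset.univ.erase 0
  have hT : T.card = Fintype.card F ^ n - 1 := by
    simp [T]
  have hS : C.ncard = S.card := Set.ncard_eq_toFinset_card C hfin
  rw [hS, ← hT, mul_comm, mul_comm T.card, mul_comm _ T.card]
  refine Finset.card_mul_le_card_mul (fun X v => Matrix.mulVec X v = 0) ?_ ?_
  · intro X hX
    have hX' : X ∈ C := by simpa [S] using hX
    rw [← card_ker_aux X (hC X hX'), ← Set.ncard_coe_finset]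
    apply le_of_eq
    congr 1
    ext v
    simp [Finset.bipartiteAbove, T]
  · intro v hv
    have hv' : v ≠ 0 := by simpa [T] using hv
    refine le_trans (le_of_eq ?_) (code_aux C hC hd v hv')
    rw [← Set.ncard_coe_finset]
    congr 1
    ext X
    simp [Finset.bipartiteBelow, S]
end

section
/- (Singleton bound for constant-rank codes) Let q be a prime power, 1 ≤ d, r ≤ n ≤ m, and let i be an integer with 0 ≤ i ≤ min{d−1, r}. Then A_R(q,m,n,d,r) ≤ A_R(q,m,n−i,d−i,J_i), where J_i = {r−i, r−i+1, …, min{n−i, r}}. -/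
open Module

theorem rank_add_le_aux {F : Type*} [Field F] {m n : ℕ} (A B : Matrix (Fin m) (Fin n) F) :
    (A + B).rank ≤ A.rank + B.rank := by
  unfold Matrix.rank
  rw [Matrix.mulVecLin_add]
  refine (Submodule.finrank_mono (LinearMap.range_add_le _ _)).trans ?_
  exact Submodule.finrank_add_le_finrank_add_finrank _ _


theorem rank_puncture {F : Type*} [Field F] {m n k i : ℕ} (hk : n = k + i)
    (X : Matrix (Fin m) (Fin n) F) :
    X.rank ≤ (X.submatrix id (Fin.castLE (by omega : k ≤ n))).rank + i := by
  classical
  subst hk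
  set E : Matrix (Fin k) (Fin (k + i)) F :=
    Matrix.of fun a b => if (a : ℕ) = b then 1 else 0 with hE
  set G : Matrix (Fin i) (Fin (k + i)) F :=
    Matrix.of fun a b => if k + (a : ℕ) = b then 1 else 0 with hG
  set Y := X.submatrix id (Fin.castLE (by omega : k ≤ k + i)) with hY
  have key : X = Y * E + (X.submatrix id (Fin.natAdd k)) * G := by
    ext a b
    rw [Matrix.add_apply, Matrix.mul_apply, Matrix.mul_apply]
    simp only [hE, hG, hY, Matrix.submatrix_apply, id, Matrix.of_apply]
    refine Fin.addCases (fun b => ?_) (fun b => ?_) b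
    · rw [Finset.sum_eq_single b, Finset.sum_eq_zero]
      · simp [Fin.castLE, Fin.castAdd]
      · intro x _
        have := b.2
        rw [if_neg (by simp; omega), mul_zero]
      · intro x _ hx
        rw [if_neg (by simpa [Fin.ext_iff] using hx), mul_zero]
      · simp
    · rw [Finset.sum_eq_zero, Finset.sum_eq_single b]
      · simp
      · intro x _ hx
        rw [if_neg (by simpa [Fin.ext_iff] using hx), mul_zero]
      · simp
      · intro x _
        have := x.2
        rw [if_neg (by simp; omega), mul_zero]
  calc X.rank = (Y * E + (X.submatrix id (Fin.natAdd k)) * G).rank := by rw [← key]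
    _ ≤ (Y * E).rank + ((X.submatrix id (Fin.natAdd k)) * G).rank := rank_add_le_aux _ _
    _ ≤ Y.rank + i := add_le_add (Matrix.rank_mul_le_left _ _)
      ((Matrix.rank_mul_le_left _ _).trans (Matrix.rank_le_width _))

theorem rank_puncture_le {F : Type*} [Field F] {m n k : ℕ} (hk : k ≤ n)
    (X : Matrix (Fin m) (Fin n) F) :
    (X.submatrix id (Fin.castLE hk)).rank ≤ X.rank := by
  have : X.submatrix id (Fin.castLE hk) =
      X * (1 : Matrix (Fin n) (Fin n) F).submatrix id (Fin.castLE hk) := by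
    ext a b
    simp [Matrix.mul_apply, Matrix.one_apply]
  rw [this]
  exact Matrix.rank_mul_le_left _ _

theorem stmt10 {q m n d r i : ℕ} (F : Type*) [Field F] [Fintype F] (hF : Fintype.card F = q)
    (hd1 : 1 ≤ d) (hr1 : 1 ≤ r) (hdn : d ≤ n) (hrn : r ≤ n) (hnm : n ≤ m)
    (hi : i ≤ min (d - 1) r) :
    A_R F m n d r ≤ maxRankCode F m (n - i) (d - i) (Set.Icc (r - i) (min (n - i) r)) := by
  classical
  have hi1 : i ≤ d - 1 := hi.trans (min_le_left _ _)
  have hi2 : i ≤ r := hi.trans (min_le_right _ _)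
  have hk : n = (n - i) + i := by omega
  unfold A_R maxRankCode
  apply csSup_le'
  rintro c ⟨C, hne, hr, hd, rfl⟩
  apply le_csSup
  · refine ⟨Nat.card (Matrix (Fin m) (Fin (n - i)) F), ?_⟩
    rintro c ⟨C, -, -, -, rfl⟩
    rw [← Set.ncard_univ]
    exact Set.ncard_le_ncard (Set.subset_univ _) (Set.toFinite _)
  set f : Matrix (Fin m) (Fin n) F → Matrix (Fin m) (Fin (n - i)) F :=
    fun X => X.submatrix id (Fin.castLE (by omega : n - i ≤ n)) with hf
  have h1 : ∀ X, X.rank ≤ (f X).rank + i := fun X => rank_puncture hk X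
  have h2 : ∀ X, (f X).rank ≤ X.rank := fun X => rank_puncture_le _ X
  have h3 : ∀ X Y, f X - f Y = f (X - Y) := fun X Y => rfl
  refine ⟨f '' C, hne.image f, ?_, ?_, ?_⟩
  · rintro _ ⟨X, hX, rfl⟩
    have e : X.rank = r := hr X hX
    have a := h1 X
    have b := h2 X
    exact ⟨by omega, le_min (Matrix.rank_le_width _) (by omega)⟩
  · rintro _ ⟨X, hX, rfl⟩ _ ⟨Y, hY, rfl⟩ hXY
    have a := h1 (X - Y)
    have b := hd X hX Y hY (fun h => hXY (by rw [h]))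
    rw [h3]
    omega
  · apply Set.ncard_image_of_injOn
    intro X hX Y hY hXY
    by_contra hne
    have a := h1 (X - Y)
    have b := hd X hX Y hY hne
    rw [← h3, sub_eq_zero.mpr hXY, Matrix.rank_zero] at a
    omega
end

section
/- Let q be a prime power and 1 ≤ d ≤ r ≤ n ≤ m. Then A_R(q,m,n,d,r) ≤ [n r]_q · α(m, r−d+1). -/
open Module

theorem aux_prod (q m s : ℕ) : ∏ i : Fin s, (q ^ m - q ^ (i : ℕ)) = alphaq q m s := by
  unfold alphaq
  exact Fin.prod_univ_eq_prod_range (fun i => q ^ m - q ^ i) s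

theorem aux_card {F V : Type*} [Field F] [Fintype F] [AddCommGroup V] [Module F V] [Finite V]
    (s : ℕ) (hs : s ≤ finrank F V) :
    Nat.card {v : Fin s → V // LinearIndependent F v}
      = alphaq (Fintype.card F) (finrank F V) s := by
  rw [← aux_prod, card_linearIndependent hs]

theorem aux_sub {F V : Type*} [Field F] [Fintype F] [AddCommGroup V] [Module F V] [Finite V]
    (r : ℕ) (hr : r ≤ finrank F V) :
    Nat.card {U : Submodule F V // finrank F U = r} ≤
      gaussBinom (Fintype.card F) (finrank F V) r := by
  classical
  have hq : 1 < Fintype.card F := Fintype.one_lt_card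
  unfold gaussBinom
  have hpos : 0 < alphaq (Fintype.card F) r r := by
    unfold alphaq
    apply Finset.prod_pos
    intro i hi
    exact Nat.sub_pos_of_lt (Nat.pow_lt_pow_right hq (Finset.mem_range.mp hi))
  rw [Nat.le_div_iff_mul_le hpos, ← aux_card r hr]
  let T := {U : Submodule F V // finrank F U = r}
  haveI : Finite (Submodule F V) :=
    Finite.of_injective (fun U : Submodule F V => (U : Set V)) SetLike.coe_injective
  haveI : Fintype T := Fintype.ofFinite T
  let S := Σ U : T, {v : Fin r → U.1 // LinearIndependent F v}
  have hS : Nat.card S = Nat.card T * alphaq (Fintype.card F) r r := by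
    rw [Nat.card_sigma]
    rw [Finset.sum_congr rfl (g := fun _ => alphaq (Fintype.card F) r r)]
    · simp [Nat.card_eq_fintype_card]
    · intro U _
      rw [aux_card r U.2.ge, U.2]
  rw [← hS]
  let g : S → {v : Fin r → V // LinearIndependent F v} := fun p =>
    ⟨fun i => (p.2.1 i : V), p.2.2.map' p.1.1.subtype (Submodule.ker_subtype _)⟩
  apply Nat.card_le_card_of_injective g
  have key : ∀ p : S, Submodule.span F (Set.range (g p).1) = p.1.1 := by
    intro p
    apply Submodule.eq_of_le_of_finrank_eq
    · rw [Submodule.span_le]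
      rintro _ ⟨i, rfl⟩
      exact (p.2.1 i).2
    · rw [finrank_span_eq_card (g p).2, Fintype.card_fin, p.1.2]
  rintro ⟨⟨U, hU⟩, v, hv⟩ ⟨⟨W, hW⟩, w, hw⟩ h
  have h1 := key ⟨⟨U, hU⟩, v, hv⟩
  rw [h, key ⟨⟨W, hW⟩, w, hw⟩] at h1
  simp only at h1
  subst h1
  have : v = w := by
    funext i
    apply Subtype.ext
    exact congrFun (congrArg Subtype.val h) i
  subst this
  rfl

theorem aux_choose {F V : Type*} [Field F] [AddCommGroup V] [Module F V]
    [FiniteDimensional F V] (K : Submodule F V) (s : ℕ) (hs : finrank F K + s ≤ finrank F V) :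
    ∃ v : Fin s → V, LinearIndependent F v ∧
      Disjoint (Submodule.span F (Set.range v)) K := by
  obtain ⟨W, hW⟩ := K.exists_isCompl
  have h1 := Submodule.finrank_add_eq_of_isCompl hW
  have h2 : s ≤ finrank F W := by omega
  let b := finBasis F W
  have hb : LinearIndependent F (fun i : Fin s => b (Fin.castLE h2 i)) :=
    b.linearIndependent.comp _ (Fin.castLE_injective h2)
  refine ⟨fun i => (b (Fin.castLE h2 i) : V), hb.map' W.subtype (Submodule.ker_subtype _), ?_⟩
  apply hW.disjoint.symm.mono_left
  rw [Submodule.span_le]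
  rintro _ ⟨i, rfl⟩
  exact (b _).2

theorem stmt11 {q m n d r : ℕ} (F : Type*) [Field F] [Fintype F] (hF : Fintype.card F = q)
    (hd1 : 1 ≤ d) (hdr : d ≤ r) (hrn : r ≤ n) (hnm : n ≤ m) :
    A_R F m n d r ≤ gaussBinom q n r * alphaq q m (r - d + 1) := by
  classical
  unfold A_R maxRankCode
  apply csSup_le'
  rintro c ⟨C, -, hCr, hCd, rfl⟩
  have hn : finrank F (Dual F (Fin n → F)) = n := by
    rw [Subspace.dual_finrank_eq]; simp
  haveI : Finite (Dual F (Fin n → F)) := Module.finite_of_finite F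
  have hT := aux_sub (F := F) (V := Dual F (Fin n → F)) r (by omega)
  have hL := aux_card (F := F) (V := Fin m → F) (r - d + 1) (by simp; omega)
  rw [hn, hF] at hT
  rw [hF, Module.finrank_fin_fun] at hL
  have hker : ∀ X : C, finrank F (LinearMap.ker X.1.mulVecLin) + r = n := by
    intro X
    have h1 := LinearMap.finrank_range_add_finrank_ker X.1.mulVecLin
    have h2 : X.1.rank = r := hCr X.1 X.2
    unfold Matrix.rank at h2
    rw [Module.finrank_fin_fun] at h1
    omega
  have hex : ∀ K : Submodule F (Fin n → F), ∃ v : Fin (r - d + 1) → Fin n → F,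
      finrank F K + r = n → LinearIndependent F v ∧
      Disjoint (Submodule.span F (Set.range v)) K := by
    intro K
    by_cases h : finrank F K + r = n
    · obtain ⟨v, hv⟩ := aux_choose K (r - d + 1) (by rw [Module.finrank_fin_fun]; omega)
      exact ⟨v, fun _ => hv⟩
    · exact ⟨0, fun h' => absurd h' h⟩
  choose v hv using hex
  let T := {U : Submodule F (Dual F (Fin n → F)) // finrank F U = r}
  let L := {w : Fin (r - d + 1) → Fin m → F // LinearIndependent F w}
  haveI : Finite (Submodule F (Dual F (Fin n → F))) :=
    Finite.of_injective (fun U : Submodule F (Dual F (Fin n → F)) =>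
      (U : Set (Dual F (Fin n → F)))) SetLike.coe_injective
  let g : C → T × L := fun X =>
    (⟨(LinearMap.ker X.1.mulVecLin).dualAnnihilator, by
      have h1 := Subspace.finrank_add_finrank_dualAnnihilator_eq (LinearMap.ker X.1.mulVecLin)
      have h2 := hker X
      rw [Module.finrank_fin_fun] at h1
      omega⟩,
     ⟨fun i => X.1.mulVecLin (v (LinearMap.ker X.1.mulVecLin) i),
      (hv _ (hker X)).1.map (hv _ (hker X)).2⟩)
  have hg : Function.Injective g := by
    intro X Y h
    have hK : LinearMap.ker X.1.mulVecLin = LinearMap.ker Y.1.mulVecLin :=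
      Subspace.dualAnnihilator_inj.mp (congrArg Subtype.val (congrArg Prod.fst h))
    have hw : ∀ i, X.1.mulVecLin (v (LinearMap.ker X.1.mulVecLin) i)
        = Y.1.mulVecLin (v (LinearMap.ker Y.1.mulVecLin) i) :=
      fun i => congrFun (congrArg Subtype.val (congrArg Prod.snd h)) i
    rw [← hK] at hw
    by_contra hne
    have hd := hCd X.1 X.2 Y.1 Y.2 (fun e => hne (Subtype.ext e))
    obtain ⟨hli, hdis⟩ := hv _ (hker X)
    have hkX := hker X
    have hmem : ∀ x, x ∈ LinearMap.ker X.1.mulVecLin → x ∈ LinearMap.ker Y.1.mulVecLin := by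
      intro x hx
      rwa [← hK]
    generalize v (LinearMap.ker X.1.mulVecLin) = u at *
    have hle : Submodule.span F (Set.range u) ⊔ LinearMap.ker X.1.mulVecLin ≤
        LinearMap.ker (X.1 - Y.1).mulVecLin := by
      apply sup_le
      · rw [Submodule.span_le]
        rintro _ ⟨i, rfl⟩
        have := hw i
        simp only [Matrix.mulVecLin_apply] at this
        simp [Matrix.sub_mulVec, this]
      · intro x hx
        have h2 := hmem x hx
        rw [LinearMap.mem_ker, Matrix.mulVecLin_apply] at *
        rw [Matrix.sub_mulVec, hx, h2, sub_zero]
    have h1 := Submodule.finrank_mono hle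
    have h2 := Submodule.finrank_sup_add_finrank_inf_eq (Submodule.span F (Set.range u))
      (LinearMap.ker X.1.mulVecLin)
    rw [hdis.eq_bot, finrank_bot, finrank_span_eq_card hli, Fintype.card_fin] at h2
    have h3 := LinearMap.finrank_range_add_finrank_ker (X.1 - Y.1).mulVecLin
    rw [Module.finrank_fin_fun] at h3
    unfold Matrix.rank at hd
    omega
  have := Nat.card_le_card_of_injective g hg
  rw [Nat.card_prod, hL] at this
  rw [← Nat.card_coe_set_eq]
  exact this.trans (Nat.mul_le_mul_right _ hT)
end
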